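/- arXiv:1702.00473 — 3 statements merged into one kernel-verified Lean document; each statement's English description precedes it below -/
import Mathlib

section
/- Monotonicity of the optimal overlaps: Let D = {λ > 0 : 𝓕(λ,·,·) has a unique maximizer (q₁*(λ), q₂*(λ)) over Γ(λ)}. Then the functions λ ∈ D ↦ q₁*(λ) and λ ∈ D ↦ q₂*(λ) are non-decreasing. -/
open MeasureTheory ProbabilityTheory Filter Real
open scoped Topology

noncomputable section

/-- Standard Gaussian measure on `ℝ`. -/
def stdG : Measure ℝ := gaussianReal 0 1

/-- The weight `exp(√γ·x·z + γ·x·x₀ − γ·x²/2)` appearing in the scalar Gaussian channel. -/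
def scalarWeight (γ x₀ z x : ℝ) : ℝ :=
  Real.exp (Real.sqrt γ * x * z + γ * x * x₀ - γ * x ^ 2 / 2)

/-- Free energy `ψ_P(γ)` of the scalar Gaussian channel with prior `P`. -/
def psiF (P : Measure ℝ) [IsProbabilityMeasure P] (γ : ℝ) : ℝ :=
  ∫ p : ℝ × ℝ, Real.log (∫ x, scalarWeight γ p.1 p.2 x ∂P) ∂(P.prod stdG)

/-- Posterior mean `⟨x⟩_γ` in the scalar Gaussian channel (`x₀` is the signal, `z` the noise). -/
def postMean (P : Measure ℝ) (γ x₀ z : ℝ) : ℝ :=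
  (∫ x, x * scalarWeight γ x₀ z x ∂P) / (∫ x, scalarWeight γ x₀ z x ∂P)

/-- Overlap `F_P(γ) = E[X₀·⟨x⟩_γ]` of the scalar Gaussian channel. -/
def Fov (P : Measure ℝ) [IsProbabilityMeasure P] (γ : ℝ) : ℝ :=
  ∫ p : ℝ × ℝ, p.1 * postMean P γ p.1 p.2 ∂(P.prod stdG)

/-- The set `Γ(λ)` of fixed points of the state evolution equations. -/
def Gam (PU PV : Measure ℝ) [IsProbabilityMeasure PU] [IsProbabilityMeasure PV]
    (lam : ℝ) : Set (ℝ × ℝ) :=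
  {q | 0 ≤ q.1 ∧ 0 ≤ q.2 ∧ q.2 = Fov PU (lam * q.1) ∧ q.1 = Fov PV (lam * q.2)}

/-- The replica-symmetric potential `𝓕(λ,q₁,q₂)`. -/
def rsF (PU PV : Measure ℝ) [IsProbabilityMeasure PU] [IsProbabilityMeasure PV]
    (lam q₁ q₂ : ℝ) : ℝ :=
  psiF PU (lam * q₁) + psiF PV (lam * q₂) - lam / 2 * q₁ * q₂

/-- Prior distribution of the pair of vectors `(u,v)`. -/
def prior (PU PV : Measure ℝ) [IsProbabilityMeasure PU] [IsProbabilityMeasure PV]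
    (n : ℕ) : Measure ((Fin n → ℝ) × (Fin n → ℝ)) :=
  (Measure.pi fun _ => PU).prod (Measure.pi fun _ => PV)

/-- Law of the Gaussian noise matrix `Z`. -/
def noiseM (n : ℕ) : Measure (Fin n → Fin n → ℝ) :=
  Measure.pi fun _ => Measure.pi fun _ => stdG

/-- Joint law of `((U,V),Z)`. -/
def sampleM (PU PV : Measure ℝ) [IsProbabilityMeasure PU] [IsProbabilityMeasure PV]
    (n : ℕ) : Measure (((Fin n → ℝ) × (Fin n → ℝ)) × (Fin n → Fin n → ℝ)) :=
  (prior PU PV n).prod (noiseM n)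

/-- Hamiltonian `H_n(u,v)` of the planted bipartite model. -/
def Ham (lam : ℝ) (n : ℕ) (U V : Fin n → ℝ) (Z : Fin n → Fin n → ℝ)
    (u v : Fin n → ℝ) : ℝ :=
  ∑ i : Fin n, ∑ j : Fin n,
    (Real.sqrt (lam / n) * u i * v j * Z i j
      + lam / n * (u i * U i * v j * V j)
      - lam / (2 * n) * (u i ^ 2 * v j ^ 2))

/-- Partition function `Z_n = ∫ e^{H_n(u,v)} dP₀ⁿ(u,v)`. -/
def partFun (PU PV : Measure ℝ) [IsProbabilityMeasure PU] [IsProbabilityMeasure PV]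
    (lam : ℝ) (n : ℕ)
    (ω : ((Fin n → ℝ) × (Fin n → ℝ)) × (Fin n → Fin n → ℝ)) : ℝ :=
  ∫ uv, Real.exp (Ham lam n ω.1.1 ω.1.2 ω.2 uv.1 uv.2) ∂(prior PU PV n)

/-- Free energy `F_n(λ) = (1/n)·E[log Z_n]`. -/
def freeEnergy (PU PV : Measure ℝ) [IsProbabilityMeasure PU] [IsProbabilityMeasure PV]
    (n : ℕ) (lam : ℝ) : ℝ :=
  (1 / (n : ℝ)) * ∫ ω, Real.log (partFun PU PV lam n ω) ∂(sampleM PU PV n)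

/-- Gibbs (posterior) expectation `⟨f(u,v)⟩` given the realization `ω = ((U,V),Z)`. -/
def gibbs (PU PV : Measure ℝ) [IsProbabilityMeasure PU] [IsProbabilityMeasure PV]
    (lam : ℝ) (n : ℕ)
    (ω : ((Fin n → ℝ) × (Fin n → ℝ)) × (Fin n → Fin n → ℝ))
    (f : (Fin n → ℝ) × (Fin n → ℝ) → ℝ) : ℝ :=
  (∫ uv, f uv * Real.exp (Ham lam n ω.1.1 ω.1.2 ω.2 uv.1 uv.2) ∂(prior PU PV n))
    / partFun PU PV lam n ω

/-- Rescaled scalar product `x·y = (1/n)·Σᵢ xᵢyᵢ`. -/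
def ovDot (n : ℕ) (x y : Fin n → ℝ) : ℝ := (1 / (n : ℝ)) * ∑ i, x i * y i

/-- Matrix minimum mean square error `MMSE_n(λ)`, with `E[U_iV_j | Y] = ⟨u_i v_j⟩` written
as the Gibbs (posterior) mean. -/
def MMSEn (PU PV : Measure ℝ) [IsProbabilityMeasure PU] [IsProbabilityMeasure PV]
    (n : ℕ) (lam : ℝ) : ℝ :=
  (1 / (n : ℝ) ^ 2) * ∑ i : Fin n, ∑ j : Fin n,
    ∫ ω, (ω.1.1 i * ω.1.2 j - gibbs PU PV lam n ω fun uv => uv.1 i * uv.2 j) ^ 2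
      ∂(sampleM PU PV n)

/-- The quantity `E⟨(u·U)(v·V)⟩`. -/
def overlapExp (PU PV : Measure ℝ) [IsProbabilityMeasure PU] [IsProbabilityMeasure PV]
    (n : ℕ) (lam : ℝ) : ℝ :=
  ∫ ω, gibbs PU PV lam n ω (fun uv => ovDot n uv.1 ω.1.1 * ovDot n uv.2 ω.1.2)
    ∂(sampleM PU PV n)

/-- `q` maximizes `𝓕(λ,·,·)` over `Γ(λ)`. -/
def isMaximizer (PU PV : Measure ℝ) [IsProbabilityMeasure PU] [IsProbabilityMeasure PV]
    (lam : ℝ) (q : ℝ × ℝ) : Prop :=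
  q ∈ Gam PU PV lam ∧ ∀ q' ∈ Gam PU PV lam, rsF PU PV lam q'.1 q'.2 ≤ rsF PU PV lam q.1 q.2

/-- The set `D` of `λ > 0` where `𝓕(λ,·,·)` has a unique maximizer over `Γ(λ)`. -/
def Dset (PU PV : Measure ℝ) [IsProbabilityMeasure PU] [IsProbabilityMeasure PV] :
    Set ℝ :=
  {lam | 0 < lam ∧ ∃! q : ℝ × ℝ, isMaximizer PU PV lam q}


lemma absFix (psU psV FU FV : ℝ → ℝ) (C lam : ℝ) (hl : 0 < lam)
    (hU : ∀ a b, 0 ≤ a → 0 ≤ b → psU a + (b - a) * FU a / 2 ≤ psU b)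
    (hV : ∀ a b, 0 ≤ a → 0 ≤ b → psV a + (b - a) * FV a / 2 ≤ psV b)
    (mU : Monotone FU) (mV : Monotone FV) (pU : ∀ a, 0 ≤ FU a) (pV : ∀ a, 0 ≤ FV a)
    (bU : ∀ a, FU a ≤ C) (cU : Continuous FU) (cV : Continuous FV)
    (cpU : Continuous psU) (cpV : Continuous psV) (r0 : ℝ) (hr0 : 0 ≤ r0) :
    ∃ r, 0 ≤ r ∧ lam * FU (lam * FV r) = r ∧
      psU (lam * FV r0) + psV r0 - r0 * FV r0 / 2 ≤ psU (lam * FV r) + psV r - r * FV r / 2 := by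
  set T : ℝ → ℝ := fun r => lam * FU (lam * FV r) with hT
  set G : ℝ → ℝ := fun r => psU (lam * FV r) + psV r - r * FV r / 2 with hG
  have hTpos : ∀ r, 0 ≤ T r := fun r => mul_nonneg hl.le (pU _)
  have hTb : ∀ r, T r ≤ lam * C := fun r => mul_le_mul_of_nonneg_left (bU _) hl.le
  have hTm : Monotone T := fun a b h =>
    mul_le_mul_of_nonneg_left (mU (mul_le_mul_of_nonneg_left (mV h) hl.le)) hl.le
  have hTc : Continuous T := by fun_prop
  have hGc : Continuous G := by fun_prop
  have step : ∀ r, 0 ≤ r → G r ≤ G (T r) := by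
    intro r hr
    have h1 := hV r (T r) hr (hTpos r)
    have h2 := hU (lam * FV r) (lam * FV (T r)) (mul_nonneg hl.le (pV _)) (mul_nonneg hl.le (pV _))
    have e : (lam * FV (T r) - lam * FV r) * FU (lam * FV r) / 2
        = (FV (T r) - FV r) * T r / 2 := by simp only [hT]; ring
    rw [e] at h2
    simp only [hG]
    nlinarith
  have itpos : ∀ n, 0 ≤ T^[n] r0 := by
    intro n
    cases n with
    | zero => simpa using hr0
    | succ n => rw [Function.iterate_succ_apply']; exact hTpos _
  have itG : ∀ n, G r0 ≤ G (T^[n] r0) := by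
    intro n
    induction n with
    | zero => simp
    | succ n ih => rw [Function.iterate_succ_apply']; exact ih.trans (step _ (itpos n))
  have key : ∃ r, Tendsto (fun n => T^[n] r0) atTop (𝓝 r) := by
    rcases le_total r0 (T r0) with h | h
    · refine ⟨_, tendsto_atTop_ciSup (hTm.monotone_iterate_of_le_map h) ⟨max r0 (lam * C), ?_⟩⟩
      rintro _ ⟨n, rfl⟩
      cases n with
      | zero => simp
      | succ n =>
        simp only [Function.iterate_succ_apply']
        exact (hTb _).trans (le_max_right _ _)
    · refine ⟨_, tendsto_atTop_ciInf (hTm.antitone_iterate_of_map_le h) ⟨0, ?_⟩⟩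
      rintro _ ⟨n, rfl⟩
      exact itpos n
  obtain ⟨r, hr⟩ := key
  refine ⟨r, ge_of_tendsto' hr itpos, isFixedPt_of_tendsto_iterate hr hTc.continuousAt, ?_⟩
  exact ge_of_tendsto' ((hGc.tendsto r).comp hr) itG

lemma absMain (psU psV FU FV : ℝ → ℝ) (C lam lam' : ℝ) (hl : 0 < lam) (hll : lam < lam')
    (hU : ∀ a b, 0 ≤ a → 0 ≤ b → psU a + (b - a) * FU a / 2 ≤ psU b)
    (hV : ∀ a b, 0 ≤ a → 0 ≤ b → psV a + (b - a) * FV a / 2 ≤ psV b)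
    (mU : Monotone FU) (mV : Monotone FV) (pU : ∀ a, 0 ≤ FU a) (pV : ∀ a, 0 ≤ FV a)
    (bU : ∀ a, FU a ≤ C) (cU : Continuous FU) (cV : Continuous FV)
    (cpU : Continuous psU) (cpV : Continuous psV)
    (q1 q2 p1 p2 : ℝ) (hq1 : 0 ≤ q1) (hq2 : 0 ≤ q2) (hp1 : 0 ≤ p1) (hp2 : 0 ≤ p2)
    (eq2 : q2 = FU (lam * q1)) (eq1 : q1 = FV (lam * q2))
    (ep1 : p1 = FV (lam' * p2))
    (hq : ∀ a b, 0 ≤ a → 0 ≤ b → b = FU (lam * a) → a = FV (lam * b) →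
      psU (lam * a) + psV (lam * b) - lam / 2 * a * b
        ≤ psU (lam * q1) + psV (lam * q2) - lam / 2 * q1 * q2)
    (hp : ∀ a b, 0 ≤ a → 0 ≤ b → b = FU (lam' * a) → a = FV (lam' * b) →
      psU (lam' * a) + psV (lam' * b) - lam' / 2 * a * b
        ≤ psU (lam' * p1) + psV (lam' * p2) - lam' / 2 * p1 * p2) :
    q1 ≤ p1 := by
  by_contra! hlt
  have hl' : 0 < lam' := hl.trans hll
  have opt : ∀ (l x y : ℝ), 0 < l → (∀ a b, 0 ≤ a → 0 ≤ b → b = FU (l * a) → a = FV (l * b) →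
      psU (l * a) + psV (l * b) - l / 2 * a * b
        ≤ psU (l * x) + psV (l * y) - l / 2 * x * y) → ∀ r, 0 ≤ r →
      psU (l * FV r) + psV r - r * FV r / 2 ≤ psU (l * x) + psV (l * y) - l / 2 * x * y := by
    intro l x y hl0 h r hr
    obtain ⟨s, hs, hfix, hle⟩ := absFix psU psV FU FV C l hl0 hU hV mU mV pU pV bU cU cV cpU cpV r hr
    have e : l * (s / l) = s := by field_simp
    have := h (FV s) (s / l) (pV _) (div_nonneg hs hl0.le)
      (by rw [div_eq_iff hl0.ne']; linarith) (by rw [e])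
    rw [e] at this
    have e2 : l / 2 * FV s * (s / l) = s * FV s / 2 := by field_simp
    linarith
  have h1 := opt lam q1 q2 hl hq (lam' * p2) (mul_nonneg hl'.le hp2)
  have h2 := opt lam' p1 p2 hl' hp (lam * q2) (mul_nonneg hl.le hq2)
  rw [← ep1] at h1
  rw [← eq1] at h2
  have hsum : psU (lam * p1) + psU (lam' * q1) ≤ psU (lam * q1) + psU (lam' * p1) := by
    nlinarith
  have hq2pos : 0 < q2 := by
    rcases hq2.eq_or_lt with h | h
    · exfalso
      rw [← h] at eq1
      have : FV (lam * 0) ≤ FV (lam' * p2) := mV (by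
        rw [mul_zero]; exact mul_nonneg hl'.le hp2)
      linarith
    · exact h
  rcases le_total (lam' * p1) (lam * q1) with hc | hc
  · have a1 := hU (lam * q1) (lam' * q1) (by positivity) (by positivity)
    have a2 := hU (lam' * p1) (lam * p1) (by positivity) (by positivity)
    have a3 : FU (lam' * p1) ≤ q2 := by rw [eq2]; exact mU hc
    rw [← eq2] at a1
    have a4 : 0 ≤ (lam' - lam) * p1 * (q2 - FU (lam' * p1)) :=
      mul_nonneg (mul_nonneg (by linarith) hp1) (by linarith)
    have a5 : 0 < (lam' - lam) * (q1 - p1) * q2 :=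
      mul_pos (mul_pos (by linarith) (by linarith)) hq2pos
    nlinarith
  · have a1 := hU (lam' * p1) (lam' * q1) (by positivity) (by positivity)
    have a2 := hU (lam * q1) (lam * p1) (by positivity) (by positivity)
    have a3 : q2 ≤ FU (lam' * p1) := by rw [eq2]; exact mU hc
    rw [← eq2] at a2
    have a4 : 0 ≤ lam' * (q1 - p1) * (FU (lam' * p1) - q2) :=
      mul_nonneg (mul_nonneg (by linarith) (by linarith)) (by linarith)
    have a5 : 0 < (lam' - lam) * (q1 - p1) * q2 :=
      mul_pos (mul_pos (by linarith) (by linarith)) hq2pos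
    nlinarith


instance stdG_prob : IsProbabilityMeasure stdG := by unfold stdG; infer_instance

/-- Cameron–Martin in one dimension. -/
lemma stdG_shift (f : ℝ → ℝ) (c : ℝ) :
    ∫ z, f (c + z) ∂stdG = ∫ y, Real.exp (c * y - c ^ 2 / 2) * f y ∂stdG := by
  unfold stdG
  rw [integral_gaussianReal_eq_integral_smul one_ne_zero,
    integral_gaussianReal_eq_integral_smul one_ne_zero]
  rw [← integral_add_left_eq_self (μ := volume)
    (fun y => gaussianPDFReal 0 1 y • (Real.exp (c * y - c ^ 2 / 2) * f y)) c]
  refine integral_congr_ae (ae_of_all _ fun z => ?_)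
  simp only [smul_eq_mul, gaussianPDFReal_def]
  rw [← mul_assoc, mul_assoc _ (rexp _) (rexp _), ← Real.exp_add]
  congr 3
  push_cast
  ring

lemma stdG_exp_abs (c : ℝ) : Integrable (fun y => Real.exp (c * |y|)) stdG :=
  integrable_exp_mul_abs (X := fun y => y) (integrable_exp_mul_gaussianReal c)
    (integrable_exp_mul_gaussianReal (-c))

lemma stdG_int {f : ℝ → ℝ} (hf : Continuous f) (B c : ℝ)
    (h : ∀ y, |f y| ≤ B * Real.exp (c * |y|)) : Integrable f stdG :=
  ((stdG_exp_abs c).const_mul B).mono' hf.aestronglyMeasurable (ae_of_all _ h)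

lemma stdG_integrable_iff (f : ℝ → ℝ) :
    Integrable f stdG ↔ Integrable (fun x => gaussianPDFReal 0 1 x * f x) := by
  unfold stdG
  rw [gaussianReal_of_var_ne_zero _ one_ne_zero,
    integrable_withDensity_iff_integrable_smul' (measurable_gaussianPDF _ _)
      (ae_of_all _ fun _ => gaussianPDF_lt_top)]
  simp [toReal_gaussianPDF]

/-- Gaussian integration by parts. -/
lemma stdG_stein (f f' : ℝ → ℝ) (hd : ∀ y, HasDerivAt f (f' y) y) (hf : Integrable f stdG)
    (hf' : Integrable (fun y => f' y - y * f y) stdG) :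
    ∫ y, (f' y - y * f y) ∂stdG = 0 := by
  have e : ∫ y, (f' y - y * f y) ∂stdG
      = ∫ y, gaussianPDFReal 0 1 y * (f' y - y * f y) := by
    unfold stdG
    rw [integral_gaussianReal_eq_integral_smul one_ne_zero]
    rfl
  rw [e]
  refine integral_eq_zero_of_hasDerivAt_of_integrable
    (f := fun y => gaussianPDFReal 0 1 y * f y) ?_
    ((stdG_integrable_iff _).1 hf') ((stdG_integrable_iff _).1 hf)
  intro y
  have h1 : HasDerivAt (gaussianPDFReal 0 1) (gaussianPDFReal 0 1 y * (-y)) y := by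
    rw [gaussianPDFReal_def]
    have h0 : HasDerivAt (fun x : ℝ => -(x - 0) ^ 2 / (2 * ((1 : NNReal) : ℝ))) (-y) y := by
      have := ((((hasDerivAt_id y).sub_const 0).pow 2).neg).div_const (2 * ((1 : NNReal) : ℝ))
      refine this.congr_deriv ?_
      simp
      ring
    refine ((h0.exp).const_mul ((√(2 * π * ((1 : NNReal) : ℝ)))⁻¹)).congr_deriv ?_
    ring
  refine (h1.mul (hd y)).congr_deriv ?_
  ring

lemma stdG_rot (ρ σ : ℝ) (h : ρ ^ 2 + σ ^ 2 = 1) :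
    (stdG.prod stdG).map (fun p : ℝ × ℝ => ρ * p.1 + σ * p.2) = stdG := by
  have h1 := gaussianReal_map_const_mul (μ := 0) (v := 1) ρ
  have h2 := gaussianReal_map_const_mul (μ := 0) (v := 1) σ
  have e : (fun p : ℝ × ℝ => ρ * p.1 + σ * p.2)
      = (fun p : ℝ × ℝ => p.1 + p.2) ∘ (Prod.map (fun x => ρ * x) (fun x => σ * x)) := by
    ext p; simp
  rw [e, ← Measure.map_map (by fun_prop) (by fun_prop),
    ← Measure.map_prod_map _ _ (by fun_prop) (by fun_prop)]
  unfold stdG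
  rw [h1, h2]
  have := gaussianReal_conv_gaussianReal (m₁ := ρ * 0) (m₂ := σ * 0)
    (v₁ := NNReal.mk (ρ ^ 2) (sq_nonneg _) * 1) (v₂ := NNReal.mk (σ ^ 2) (sq_nonneg _) * 1)
  rw [Measure.conv] at this
  rw [this]
  congr 1
  · simp
  · ext; simpa using h

lemma stdG_mgf (t : ℝ) : ∫ y, Real.exp (t * y) ∂stdG = Real.exp (t ^ 2 / 2) := by
  have := congrFun (mgf_fun_id_gaussianReal (μ := 0) (v := 1)) t
  simpa [mgf, stdG] using this

/-- Finite weighted sums of exponential martingales. -/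
def AA (S : Finset ℝ) (w : ℝ → ℝ) (k : ℕ) (s y : ℝ) : ℝ :=
  ∑ x ∈ S, w x * x ^ k * Real.exp (s * x * y - s ^ 2 * x ^ 2 / 2)

structure WP (S : Finset ℝ) (w : ℝ → ℝ) (K : ℝ) : Prop where
  nn : ∀ x ∈ S, 0 ≤ w x
  one : ∑ x ∈ S, w x = 1
  K0 : 0 ≤ K
  le : ∀ x ∈ S, |x| ≤ K

section
variable {S : Finset ℝ} {w : ℝ → ℝ} {K : ℝ}

lemma AA_cont (k : ℕ) : Continuous (fun p : ℝ × ℝ => AA S w k p.1 p.2) := by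
  unfold AA; fun_prop

lemma AA_cont_y (k : ℕ) (s : ℝ) : Continuous (AA S w k s) := by
  unfold AA; fun_prop

lemma AA_cont_s (k : ℕ) (y : ℝ) : Continuous (fun s => AA S w k s y) := by
  unfold AA; fun_prop

lemma AA_deriv_y (k : ℕ) (s y : ℝ) : HasDerivAt (AA S w k s) (s * AA S w (k + 1) s y) y := by
  unfold AA
  rw [Finset.mul_sum]
  refine HasDerivAt.fun_sum fun x _ => ?_
  have h0 : HasDerivAt (fun y : ℝ => s * x * y - s ^ 2 * x ^ 2 / 2) (s * x) y := by
    simpa using ((hasDerivAt_id y).const_mul (s * x)).sub_const (s ^ 2 * x ^ 2 / 2)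
  refine (h0.exp.const_mul (w x * x ^ k)).congr_deriv ?_
  ring

lemma AA_deriv_s (k : ℕ) (s y : ℝ) :
    HasDerivAt (fun s => AA S w k s y) (y * AA S w (k + 1) s y - s * AA S w (k + 2) s y) s := by
  unfold AA
  rw [Finset.mul_sum, Finset.mul_sum, ← Finset.sum_sub_distrib]
  refine HasDerivAt.fun_sum fun x _ => ?_
  have h0 : HasDerivAt (fun s : ℝ => s * x * y - s ^ 2 * x ^ 2 / 2) (x * y - s * x ^ 2) s := by
    have h1 := ((hasDerivAt_id s).mul_const x).mul_const y
    have h2 := (((hasDerivAt_id s).pow 2).mul_const (x ^ 2)).div_const 2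
    refine (h1.sub h2).congr_deriv ?_
    simp
    ring
  refine (h0.exp.const_mul (w x * x ^ k)).congr_deriv ?_
  ring

lemma AA_lower (h : WP S w K) {R s y : ℝ} (hs : |s| ≤ R) :
    Real.exp (-(R * K * |y| + R ^ 2 * K ^ 2 / 2)) ≤ AA S w 0 s y := by
  have : Real.exp (-(R * K * |y| + R ^ 2 * K ^ 2 / 2))
      = ∑ x ∈ S, w x * Real.exp (-(R * K * |y| + R ^ 2 * K ^ 2 / 2)) := by
    rw [← Finset.sum_mul, h.one, one_mul]
  rw [this]
  unfold AA
  refine Finset.sum_le_sum fun x hx => ?_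
  rw [pow_zero, mul_one]
  refine mul_le_mul_of_nonneg_left (Real.exp_le_exp.2 ?_) (h.nn x hx)
  have hR : 0 ≤ R := (abs_nonneg s).trans hs
  have h1 : |s * x * y| ≤ R * K * |y| := by
    rw [abs_mul, abs_mul]
    have := mul_le_mul hs (h.le x hx) (abs_nonneg _) hR
    exact mul_le_mul_of_nonneg_right this (abs_nonneg _)
  have h2 : s ^ 2 * x ^ 2 ≤ R ^ 2 * K ^ 2 := by
    rw [← sq_abs s, ← sq_abs x]
    have := h.le x hx
    have := h.K0
    gcongr
  have := neg_abs_le (s * x * y)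
  linarith

lemma AA_pos (h : WP S w K) (s y : ℝ) : 0 < AA S w 0 s y :=
  (Real.exp_pos _).trans_le (AA_lower h le_rfl)

lemma AA_upper (h : WP S w K) {R s y : ℝ} (hs : |s| ≤ R) :
    AA S w 0 s y ≤ Real.exp (R * K * |y|) := by
  have : Real.exp (R * K * |y|) = ∑ x ∈ S, w x * Real.exp (R * K * |y|) := by
    rw [← Finset.sum_mul, h.one, one_mul]
  rw [this]
  unfold AA
  refine Finset.sum_le_sum fun x hx => ?_
  rw [pow_zero, mul_one]
  refine mul_le_mul_of_nonneg_left (Real.exp_le_exp.2 ?_) (h.nn x hx)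
  have hR : 0 ≤ R := (abs_nonneg s).trans hs
  have h1 : |s * x * y| ≤ R * K * |y| := by
    rw [abs_mul, abs_mul]
    have := mul_le_mul hs (h.le x hx) (abs_nonneg _) hR
    exact mul_le_mul_of_nonneg_right this (abs_nonneg _)
  have := le_abs_self (s * x * y)
  have : 0 ≤ s ^ 2 * x ^ 2 := by positivity
  linarith

lemma AA_abs (h : WP S w K) (k : ℕ) (s y : ℝ) : |AA S w k s y| ≤ K ^ k * AA S w 0 s y := by
  unfold AA
  rw [Finset.mul_sum]
  refine (Finset.abs_sum_le_sum_abs _ _).trans (Finset.sum_le_sum fun x hx => ?_)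
  rw [abs_mul, abs_mul, abs_of_nonneg (h.nn x hx), abs_of_pos (Real.exp_pos _), abs_pow]
  have h1 : |x| ^ k ≤ K ^ k := pow_le_pow_left₀ (abs_nonneg _) (h.le x hx) k
  have := h.nn x hx
  calc _ ≤ w x * K ^ k * rexp (s * x * y - s ^ 2 * x ^ 2 / 2) := by gcongr
    _ = _ := by ring

lemma AA_absR (h : WP S w K) (k : ℕ) {R s : ℝ} (hs : |s| ≤ R) (y : ℝ) :
    |AA S w k s y| ≤ K ^ k * Real.exp (R * K * |y|) :=
  (AA_abs h k s y).trans (mul_le_mul_of_nonneg_left (AA_upper h hs) (pow_nonneg h.K0 _))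

lemma AA_log (h : WP S w K) {R s : ℝ} (hs : |s| ≤ R) (y : ℝ) :
    |Real.log (AA S w 0 s y)| ≤ R * K * |y| + R ^ 2 * K ^ 2 / 2 := by
  have h1 := Real.log_le_log (Real.exp_pos _) (AA_lower h hs (y := y))
  have h2 := Real.log_le_log (AA_pos h s y) (AA_upper h hs (y := y))
  rw [Real.log_exp] at h1 h2
  have : 0 ≤ R ^ 2 * K ^ 2 := by positivity
  exact abs_le.2 ⟨h1, by linarith⟩

lemma AA_int (h : WP S w K) (k : ℕ) (s : ℝ) : Integrable (AA S w k s) stdG :=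
  stdG_int (AA_cont_y k s) _ _ fun y => AA_absR h k le_rfl y

/-- The integrand of the overlap. -/
def QQ (S : Finset ℝ) (w : ℝ → ℝ) (s y : ℝ) : ℝ := AA S w 1 s y ^ 2 / AA S w 0 s y

lemma QQ_cont_y (h : WP S w K) (s : ℝ) : Continuous (QQ S w s) := by
  unfold QQ
  exact ((AA_cont_y 1 s).pow 2).div (AA_cont_y 0 s) fun y => (AA_pos h s y).ne'

lemma QQ_cont_s (h : WP S w K) (y : ℝ) : Continuous (fun s => QQ S w s y) := by
  unfold QQ
  exact ((AA_cont_s 1 y).pow 2).div (AA_cont_s 0 y) fun s => (AA_pos h s y).ne'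

lemma QQ_nonneg (h : WP S w K) (s y : ℝ) : 0 ≤ QQ S w s y :=
  div_nonneg (sq_nonneg _) (AA_pos h s y).le

lemma QQ_le (h : WP S w K) (s y : ℝ) : QQ S w s y ≤ K ^ 2 * AA S w 0 s y := by
  unfold QQ
  rw [div_le_iff₀ (AA_pos h s y), ← sq_abs]
  have := AA_abs h 1 s y
  rw [pow_one] at this
  calc _ ≤ (K * AA S w 0 s y) ^ 2 := pow_le_pow_left₀ (abs_nonneg _) this 2
    _ = _ := by ring

lemma QQ_absR (h : WP S w K) {R s : ℝ} (hs : |s| ≤ R) (y : ℝ) :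
    |QQ S w s y| ≤ K ^ 2 * Real.exp (R * K * |y|) := by
  rw [abs_of_nonneg (QQ_nonneg h s y)]
  exact (QQ_le h s y).trans (mul_le_mul_of_nonneg_left (AA_upper h hs) (pow_nonneg h.K0 _))

lemma QQ_int (h : WP S w K) (s : ℝ) : Integrable (QQ S w s) stdG :=
  stdG_int (QQ_cont_y h s) _ _ fun y => QQ_absR h le_rfl y

/-- Overlap as a function of `s = √γ`. -/
def PhiS (S : Finset ℝ) (w : ℝ → ℝ) (s : ℝ) : ℝ := ∫ y, QQ S w s y ∂stdG

/-- Free energy as a function of `s = √γ`. -/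
def PsiS (S : Finset ℝ) (w : ℝ → ℝ) (s : ℝ) : ℝ :=
  ∫ y, AA S w 0 s y * Real.log (AA S w 0 s y) ∂stdG

lemma PhiS_cont (h : WP S w K) : Continuous (PhiS S w) := by
  rw [continuous_iff_continuousAt]
  intro s
  refine continuousAt_of_dominated (bound := fun y => K ^ 2 * Real.exp ((|s| + 1) * K * |y|)) ?_ ?_
    ((stdG_exp_abs _).const_mul _) (ae_of_all _ fun y => (QQ_cont_s h y).continuousAt)
  · exact Eventually.of_forall fun t => (QQ_cont_y h t).aestronglyMeasurable
  · have : ∀ᶠ t in 𝓝 s, |t| < |s| + 1 :=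
      (continuous_abs.tendsto s).eventually (gt_mem_nhds (by linarith))
    filter_upwards [this] with t ht
    exact ae_of_all _ fun y => QQ_absR h ht.le y

lemma PhiS_nonneg (h : WP S w K) (s : ℝ) : 0 ≤ PhiS S w s :=
  integral_nonneg fun y => QQ_nonneg h s y

/-- The Mehler semigroup identity. -/
lemma AA_mehler (k : ℕ) (a b ρ σ : ℝ) (h1 : ρ ^ 2 + σ ^ 2 = 1) (h2 : b * ρ = a)
    (y : ℝ) : ∫ z, AA S w k b (ρ * y + σ * z) ∂stdG = AA S w k a y := by
  have e : ∀ x z : ℝ, w x * x ^ k * rexp (b * x * (ρ * y + σ * z) - b ^ 2 * x ^ 2 / 2)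
      = (w x * x ^ k * rexp (a * x * y - b ^ 2 * x ^ 2 / 2)) * rexp ((b * x * σ) * z) := by
    intro x z
    rw [mul_assoc _ (rexp _) (rexp _), ← Real.exp_add]
    congr 2
    rw [← h2]; ring
  unfold AA
  simp_rw [e]
  rw [integral_finsetSum]
  · refine Finset.sum_congr rfl fun x _ => ?_
    rw [integral_const_mul, stdG_mgf, mul_assoc _ (rexp _) (rexp _), ← Real.exp_add]
    congr 2
    rw [← h2]
    linear_combination (b ^ 2 * x ^ 2 / 2) * h1
  · intro x _
    exact (integrable_exp_mul_gaussianReal _).const_mul _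

lemma AA_mass (h : WP S w K) (s : ℝ) : ∫ y, AA S w 0 s y ∂stdG = 1 := by
  have := AA_mehler (S := S) (w := w) 0 0 s 0 1 (by norm_num) (by simp) 0
  simp only [zero_mul, zero_add, one_mul] at this
  rw [this]
  simp [AA, h.one]

lemma PhiS_le (h : WP S w K) (s : ℝ) : PhiS S w s ≤ K ^ 2 := by
  calc PhiS S w s ≤ ∫ y, K ^ 2 * AA S w 0 s y ∂stdG :=
        integral_mono (QQ_int h s) ((AA_int h 0 s).const_mul _) fun y => QQ_le h s y
    _ = K ^ 2 := by rw [integral_const_mul, AA_mass h, mul_one]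

lemma PhiS_mono (h : WP S w K) {a b : ℝ} (ha : 0 ≤ a) (hab : a ≤ b) :
    PhiS S w a ≤ PhiS S w b := by
  rcases hab.eq_or_lt with rfl | hlt
  · exact le_rfl
  have hb : 0 < b := ha.trans_lt hlt
  set ρ := a / b with hρ
  have hρ1 : ρ ≤ 1 := by rw [hρ, div_le_one hb]; exact hab
  have hρ0 : 0 ≤ ρ := div_nonneg ha hb.le
  set σ := Real.sqrt (1 - ρ ^ 2) with hσ
  have h1 : ρ ^ 2 + σ ^ 2 = 1 := by
    rw [hσ, Real.sq_sqrt (by nlinarith)]; ring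
  have h2 : b * ρ = a := by rw [hρ]; field_simp
  have hrot := stdG_rot ρ σ h1
  have hmeas : AEMeasurable (fun p : ℝ × ℝ => ρ * p.1 + σ * p.2) (stdG.prod stdG) := by fun_prop
  have hint : Integrable (fun p : ℝ × ℝ => QQ S w b (ρ * p.1 + σ * p.2)) (stdG.prod stdG) := by
    have := QQ_int h b
    rw [← hrot] at this
    exact this.comp_aemeasurable hmeas
  have e1 : PhiS S w b = ∫ y, ∫ z, QQ S w b (ρ * y + σ * z) ∂stdG ∂stdG := by
    rw [← integral_prod (fun p : ℝ × ℝ => QQ S w b (ρ * p.1 + σ * p.2)) hint,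
      ← integral_map hmeas (QQ_cont_y h b).aestronglyMeasurable, hrot]
    rfl
  rw [e1]
  have hAint : ∀ k y, Integrable (fun z => AA S w k b (ρ * y + σ * z)) stdG := by
    intro k y
    refine stdG_int ((AA_cont_y k b).comp (by fun_prop))
      (K ^ k * Real.exp (|b| * K * (|ρ| * |y|))) (|b| * K * |σ|) fun z => ?_
    refine (AA_absR h k le_rfl _).trans ?_
    rw [mul_assoc (K ^ k) (rexp _) (rexp _), ← Real.exp_add]
    refine mul_le_mul_of_nonneg_left (Real.exp_le_exp.2 ?_) (pow_nonneg h.K0 _)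
    have : |ρ * y + σ * z| ≤ |ρ| * |y| + |σ| * |z| := by
      refine (abs_add_le _ _).trans ?_
      rw [abs_mul, abs_mul]
    have hbK : 0 ≤ |b| * K := mul_nonneg (abs_nonneg _) h.K0
    calc _ ≤ |b| * K * (|ρ| * |y| + |σ| * |z|) := mul_le_mul_of_nonneg_left this hbK
      _ = _ := by ring
  have hQint : ∀ y, Integrable (fun z => QQ S w b (ρ * y + σ * z)) stdG := by
    intro y
    refine ((hAint 0 y).const_mul (K ^ 2)).mono'
      ((QQ_cont_y h b).comp (by fun_prop)).aestronglyMeasurable (ae_of_all _ fun z => ?_)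
    rw [Real.norm_eq_abs, abs_of_nonneg (QQ_nonneg h _ _)]
    exact QQ_le h _ _
  refine integral_mono (QQ_int h a) hint.integral_prod_left fun y => ?_
  set m := AA S w 1 a y / AA S w 0 a y with hm
  have hp := AA_pos h a y
  have e2 : QQ S w a y = 2 * m * AA S w 1 a y - m ^ 2 * AA S w 0 a y := by
    rw [hm]; unfold QQ; field_simp; ring
  have e3 : QQ S w a y = ∫ z, (2 * m * AA S w 1 b (ρ * y + σ * z)
      - m ^ 2 * AA S w 0 b (ρ * y + σ * z)) ∂stdG := by
    rw [integral_sub ((hAint 1 y).const_mul _) ((hAint 0 y).const_mul _), integral_const_mul,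
      integral_const_mul, AA_mehler 1 a b ρ σ h1 h2, AA_mehler 0 a b ρ σ h1 h2, e2]
  rw [e3]
  refine integral_mono (((hAint 1 y).const_mul _).sub ((hAint 0 y).const_mul _)) (hQint y)
    fun z => ?_
  have hp' := AA_pos h b (ρ * y + σ * z)
  simp only [QQ]
  rw [le_div_iff₀ hp']
  nlinarith [sq_nonneg (AA S w 1 b (ρ * y + σ * z) - m * AA S w 0 b (ρ * y + σ * z))]

end

section
variable {S : Finset ℝ} {w : ℝ → ℝ} {K : ℝ}

/-- Derivative in `s` of the free energy integrand. -/
def DD (S : Finset ℝ) (w : ℝ → ℝ) (s y : ℝ) : ℝ :=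
  (y * AA S w 1 s y - s * AA S w 2 s y) * (Real.log (AA S w 0 s y) + 1)

lemma logA_cont (h : WP S w K) (s : ℝ) : Continuous fun y => Real.log (AA S w 0 s y) :=
  (AA_cont_y 0 s).log fun y => (AA_pos h s y).ne'

lemma DD_cont (h : WP S w K) (s : ℝ) : Continuous (DD S w s) := by
  have h1 := logA_cont h s
  have h2 := AA_cont_y (S := S) (w := w) 1 s
  have h3 := AA_cont_y (S := S) (w := w) 2 s
  unfold DD
  fun_prop

lemma log_one_bound (h : WP S w K) {R s : ℝ} (hs : |s| ≤ R) (y : ℝ) :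
    |Real.log (AA S w 0 s y) + 1| ≤ (R * K + R ^ 2 * K ^ 2 / 2 + 1) * Real.exp |y| := by
  have hR : 0 ≤ R := (abs_nonneg s).trans hs
  have hRK : 0 ≤ R * K := mul_nonneg hR h.K0
  have h1 := AA_log h hs y
  have h2 : |Real.log (AA S w 0 s y) + 1| ≤ R * K * |y| + R ^ 2 * K ^ 2 / 2 + 1 := by
    refine (abs_add_le _ _).trans ?_
    rw [abs_one]; linarith
  have h3 : |y| + 1 ≤ Real.exp |y| := Real.add_one_le_exp _
  have h4 : 0 ≤ R ^ 2 * K ^ 2 := by positivity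
  have h5 : 0 ≤ |y| := abs_nonneg y
  refine h2.trans ?_
  calc _ ≤ (R * K + R ^ 2 * K ^ 2 / 2 + 1) * (|y| + 1) := by nlinarith
    _ ≤ _ := by gcongr

lemma DD_bound (h : WP S w K) {R s : ℝ} (hs : |s| ≤ R) (y : ℝ) :
    |DD S w s y| ≤ ((K + R * K ^ 2) * (R * K + R ^ 2 * K ^ 2 / 2 + 1))
      * Real.exp ((R * K + 2) * |y|) := by
  have hR : 0 ≤ R := (abs_nonneg s).trans hs
  have hK := h.K0
  have h1 := log_one_bound h hs y
  have h3 : |y| + 1 ≤ Real.exp |y| := Real.add_one_le_exp _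
  have h2 : |y * AA S w 1 s y - s * AA S w 2 s y|
      ≤ (K + R * K ^ 2) * Real.exp |y| * Real.exp (R * K * |y|) := by
    refine (abs_sub _ _).trans ?_
    rw [abs_mul, abs_mul]
    have a1 := AA_absR h 1 hs y
    have a2 := AA_absR h 2 hs y
    have b1 : |y| * |AA S w 1 s y| ≤ |y| * (K ^ 1 * rexp (R * K * |y|)) := by gcongr
    have b2 : |s| * |AA S w 2 s y| ≤ R * (K ^ 2 * rexp (R * K * |y|)) := by gcongr
    have h5 : 0 ≤ |y| := abs_nonneg y
    calc _ ≤ (K * |y| + R * K ^ 2) * rexp (R * K * |y|) := by nlinarith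
      _ ≤ ((K + R * K ^ 2) * (|y| + 1)) * rexp (R * K * |y|) := by
          gcongr
          nlinarith [mul_nonneg (mul_nonneg hR (sq_nonneg K)) h5]
      _ ≤ _ := by gcongr
  unfold DD
  rw [abs_mul]
  calc _ ≤ ((K + R * K ^ 2) * Real.exp |y| * Real.exp (R * K * |y|))
        * ((R * K + R ^ 2 * K ^ 2 / 2 + 1) * Real.exp |y|) :=
        mul_le_mul h2 h1 (abs_nonneg _) (by positivity)
    _ = ((K + R * K ^ 2) * (R * K + R ^ 2 * K ^ 2 / 2 + 1))
        * (Real.exp |y| * Real.exp (R * K * |y|) * Real.exp |y|) := by ring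
    _ = _ := by
        rw [← Real.exp_add, ← Real.exp_add]
        congr 2
        ring

lemma DD_int (h : WP S w K) (s : ℝ) : Integrable (DD S w s) stdG :=
  stdG_int (DD_cont h s) _ _ fun y => DD_bound h le_rfl y

lemma LlogL_cont (h : WP S w K) (s : ℝ) :
    Continuous fun y => AA S w 0 s y * Real.log (AA S w 0 s y) :=
  (AA_cont_y 0 s).mul (logA_cont h s)

lemma Alog_int (h : WP S w K) (k : ℕ) (s : ℝ) :
    Integrable (fun y => AA S w k s y * (Real.log (AA S w 0 s y) + 1)) stdG := by
  refine stdG_int ((AA_cont_y k s).mul ((logA_cont h s).add continuous_const))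
    (K ^ k * (|s| * K + |s| ^ 2 * K ^ 2 / 2 + 1)) (|s| * K + 1) fun y => ?_
  have hK := h.K0
  rw [abs_mul]
  calc _ ≤ (K ^ k * Real.exp (|s| * K * |y|))
        * ((|s| * K + |s| ^ 2 * K ^ 2 / 2 + 1) * Real.exp |y|) :=
        mul_le_mul (AA_absR h k le_rfl y) (log_one_bound h le_rfl y) (abs_nonneg _)
          (by positivity)
    _ = (K ^ k * (|s| * K + |s| ^ 2 * K ^ 2 / 2 + 1))
        * (Real.exp (|s| * K * |y|) * Real.exp |y|) := by ring
    _ = _ := by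
        rw [← Real.exp_add]
        congr 2
        ring

lemma LlogL_int (h : WP S w K) (s : ℝ) :
    Integrable (fun y => AA S w 0 s y * Real.log (AA S w 0 s y)) stdG := by
  refine ((Alog_int h 0 s).sub (AA_int h 0 s)).congr (ae_of_all _ fun y => ?_)
  simp only [Pi.sub_apply]
  ring

lemma DD_integral (h : WP S w K) (s : ℝ) : ∫ y, DD S w s y ∂stdG = s * PhiS S w s := by
  have hd : ∀ y, HasDerivAt (fun y => AA S w 1 s y * (Real.log (AA S w 0 s y) + 1))
      (s * AA S w 2 s y * (Real.log (AA S w 0 s y) + 1)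
        + AA S w 1 s y * (s * AA S w 1 s y / AA S w 0 s y)) y := by
    intro y
    have h1 := AA_deriv_y (S := S) (w := w) 1 s y
    have h0 := (AA_deriv_y (S := S) (w := w) 0 s y).log (AA_pos h s y).ne'
    exact h1.mul (h0.add_const 1)
  have e : ∀ y, (s * AA S w 2 s y * (Real.log (AA S w 0 s y) + 1)
        + AA S w 1 s y * (s * AA S w 1 s y / AA S w 0 s y))
        - y * (AA S w 1 s y * (Real.log (AA S w 0 s y) + 1)) = s * QQ S w s y - DD S w s y := by
    intro y
    unfold QQ DD
    ring
  have key := stdG_stein _ _ hd (Alog_int h 1 s) (by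
    simp_rw [e]
    exact ((QQ_int h s).const_mul s).sub (DD_int h s))
  simp_rw [e] at key
  rw [integral_sub ((QQ_int h s).const_mul s) (DD_int h s), integral_const_mul] at key
  unfold PhiS
  linarith

lemma PsiS_deriv (h : WP S w K) (s : ℝ) : HasDerivAt (PsiS S w) (s * PhiS S w s) s := by
  rw [← DD_integral h s]
  refine (hasDerivAt_integral_of_dominated_loc_of_deriv_le (μ := stdG)
    (F := fun s y => AA S w 0 s y * Real.log (AA S w 0 s y)) (F' := fun s y => DD S w s y)
    (s := {t | |t| < |s| + 1})
    ((isOpen_lt continuous_abs continuous_const).mem_nhds (by simp))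
    (Eventually.of_forall fun t => (LlogL_cont h t).aestronglyMeasurable)
    (LlogL_int h s) (DD_cont h s).aestronglyMeasurable
    (ae_of_all _ fun y t ht => DD_bound h (le_of_lt ht) y)
    ((stdG_exp_abs _).const_mul _) (ae_of_all _ fun y t _ => ?_)).2
  have h1 := AA_deriv_s (S := S) (w := w) 0 t y
  have hp := AA_pos h t y
  refine (h1.mul (h1.log hp.ne')).congr_deriv ?_
  unfold DD
  simp only [zero_add]
  field_simp

lemma PsiS_subgrad (h : WP S w K) {s t : ℝ} (hs : 0 ≤ s) (ht : 0 ≤ t) :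
    PsiS S w s + (t ^ 2 - s ^ 2) * PhiS S w s / 2 ≤ PsiS S w t := by
  set D : ℝ → ℝ := fun u => PsiS S w u - u ^ 2 * (PhiS S w s / 2) with hD
  have hd : ∀ u, HasDerivAt D (u * (PhiS S w u - PhiS S w s)) u := by
    intro u
    have h2 := ((hasDerivAt_id u).pow 2).mul_const (PhiS S w s / 2)
    refine ((PsiS_deriv h u).sub h2).congr_deriv ?_
    simp
    ring
  have hc : Continuous D := continuous_iff_continuousAt.2 fun u => (hd u).continuousAt
  suffices D s ≤ D t by simp only [hD] at this; linarith
  rcases le_total s t with hst | hst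
  · refine monotoneOn_of_deriv_nonneg (convex_Icc s t) hc.continuousOn
      (fun u _ => (hd u).differentiableAt.differentiableWithinAt) ?_
      (Set.left_mem_Icc.2 hst) (Set.right_mem_Icc.2 hst) hst
    intro u hu
    rw [(hd u).deriv]
    rw [interior_Icc] at hu
    exact mul_nonneg (hs.trans hu.1.le) (sub_nonneg.2 (PhiS_mono h hs hu.1.le))
  · refine antitoneOn_of_deriv_nonpos (convex_Icc t s) hc.continuousOn
      (fun u _ => (hd u).differentiableAt.differentiableWithinAt) ?_
      (Set.left_mem_Icc.2 hst) (Set.right_mem_Icc.2 hst) hst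
    intro u hu
    rw [(hd u).deriv]
    rw [interior_Icc] at hu
    have hu0 : 0 ≤ u := ht.trans hu.1.le
    exact mul_nonpos_of_nonneg_of_nonpos hu0 (sub_nonpos.2 (PhiS_mono h hu0 hu.2.le))

end

section conversion
variable (P : Measure ℝ) [IsProbabilityMeasure P] (S : Finset ℝ)

lemma fin_restrict (hS : P ((↑S : Set ℝ)ᶜ) = 0) : P.restrict (↑S : Set ℝ) = P :=
  Measure.restrict_eq_self_of_ae_mem (by rw [ae_iff]; exact hS)

lemma fin_integrable (hS : P ((↑S : Set ℝ)ᶜ) = 0) (f : ℝ → ℝ) : Integrable f P := by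
  rw [← fin_restrict P S hS]
  exact IntegrableOn.finset

lemma fin_integral (hS : P ((↑S : Set ℝ)ᶜ) = 0) (f : ℝ → ℝ) :
    ∫ x, f x ∂P = ∑ x ∈ S, P.real {x} * f x := by
  conv_lhs => rw [← fin_restrict P S hS]
  rw [setIntegral_finset _ IntegrableOn.finset]
  simp

lemma fin_WP {K : ℝ} (hSK : ∀ x ∈ S, |x| ≤ K) (hS : P ((↑S : Set ℝ)ᶜ) = 0) :
    WP S (fun x => P.real {x}) K := by
  have h1 : ∑ x ∈ S, P.real {x} = 1 := by
    have := fin_integral P S hS (fun _ => 1)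
    simpa using this.symm
  refine ⟨fun x _ => measureReal_nonneg, h1, ?_, hSK⟩
  have : S.Nonempty := by
    rw [Finset.nonempty_iff_ne_empty]
    rintro rfl
    simp at h1
  obtain ⟨x, hx⟩ := this
  exact (abs_nonneg x).trans (hSK x hx)

lemma fin_prod (hS : P ((↑S : Set ℝ)ᶜ) = 0) (f : ℝ × ℝ → ℝ) (hf : Continuous f)
    (hi : ∀ x, Integrable (fun z => f (x, z)) stdG) :
    ∫ p, f p ∂(P.prod stdG) = ∑ x ∈ S, P.real {x} * ∫ z, f (x, z) ∂stdG := by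
  have hint : Integrable f (P.prod stdG) := by
    rw [integrable_prod_iff hf.aestronglyMeasurable]
    exact ⟨ae_of_all _ hi, fin_integrable P S hS _⟩
  rw [integral_prod f hint, fin_integral P S hS]

lemma weight_eq {s : ℝ} (hs : 0 ≤ s) (x₀ z x : ℝ) :
    scalarWeight (s ^ 2) x₀ z x = Real.exp (s * x * (s * x₀ + z) - s ^ 2 * x ^ 2 / 2) := by
  unfold scalarWeight
  rw [Real.sqrt_sq hs]
  congr 1
  ring

lemma den_eq (hS : P ((↑S : Set ℝ)ᶜ) = 0) {s : ℝ} (hs : 0 ≤ s) (x₀ z : ℝ) :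
    ∫ x, scalarWeight (s ^ 2) x₀ z x ∂P = AA S (fun x => P.real {x}) 0 s (s * x₀ + z) := by
  rw [fin_integral P S hS]
  unfold AA
  simp_rw [weight_eq hs]
  simp

lemma num_eq (hS : P ((↑S : Set ℝ)ᶜ) = 0) {s : ℝ} (hs : 0 ≤ s) (x₀ z : ℝ) :
    ∫ x, x * scalarWeight (s ^ 2) x₀ z x ∂P = AA S (fun x => P.real {x}) 1 s (s * x₀ + z) := by
  rw [fin_integral P S hS]
  unfold AA
  simp_rw [weight_eq hs]
  simp [mul_assoc]

lemma shift_sum (k : ℕ) (w : ℝ → ℝ) (s : ℝ) (g : ℝ → ℝ)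
    (hg : ∀ x, Integrable (fun y => Real.exp (s * x * y - (s * x) ^ 2 / 2) * g y) stdG) :
    ∑ x ∈ S, w x * (x ^ k * ∫ z, g (s * x + z) ∂stdG) = ∫ y, AA S w k s y * g y ∂stdG := by
  unfold AA
  simp_rw [Finset.sum_mul]
  have e : ∀ x y : ℝ, w x * x ^ k * rexp (s * x * y - s ^ 2 * x ^ 2 / 2) * g y
      = (w x * x ^ k) * (rexp (s * x * y - (s * x) ^ 2 / 2) * g y) := by
    intro x y; rw [mul_pow]; ring
  simp_rw [e]
  rw [integral_finsetSum _ fun x _ => (hg x).const_mul _]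
  refine Finset.sum_congr rfl fun x _ => ?_
  rw [integral_const_mul, stdG_shift, mul_assoc]

lemma Fov_eq {K : ℝ} (hSK : ∀ x ∈ S, |x| ≤ K) (hS : P ((↑S : Set ℝ)ᶜ) = 0) {s : ℝ}
    (hs : 0 ≤ s) : Fov P (s ^ 2) = PhiS S (fun x => P.real {x}) s := by
  have h := fin_WP P S hSK hS
  set w : ℝ → ℝ := fun x => P.real {x} with hw
  set m : ℝ → ℝ := fun y => AA S w 1 s y / AA S w 0 s y with hm
  have hmc : Continuous m := (AA_cont_y 1 s).div (AA_cont_y 0 s) fun y => (AA_pos h s y).ne'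
  have hmb : ∀ y, |m y| ≤ K := by
    intro y
    simp only [hm]
    rw [abs_div, abs_of_pos (AA_pos h s y), div_le_iff₀ (AA_pos h s y)]
    simpa using AA_abs h 1 s y
  unfold Fov postMean
  simp_rw [den_eq P S hS hs, num_eq P S hS hs]
  have e : ∀ p : ℝ × ℝ, p.1 * (AA S w 1 s (s * p.1 + p.2) / AA S w 0 s (s * p.1 + p.2))
      = p.1 * m (s * p.1 + p.2) := fun p => rfl
  simp_rw [← hw, e]
  rw [fin_prod P S hS (fun p : ℝ × ℝ => p.1 * m (s * p.1 + p.2)) (by fun_prop)]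
  · have := shift_sum S 1 w s m (fun x => by
      refine stdG_int (by fun_prop) K |s * x| fun y => ?_
      rw [abs_mul, abs_of_pos (Real.exp_pos _), mul_comm]
      refine mul_le_mul (hmb y) (Real.exp_le_exp.2 ?_) (Real.exp_pos _).le h.K0
      have := le_abs_self (s * x * y)
      rw [abs_mul (s * x)] at this
      have := sq_nonneg (s * x)
      linarith)
    simp only [pow_one] at this
    simp_rw [integral_const_mul]
    rw [this]
    unfold PhiS QQ
    refine integral_congr_ae (ae_of_all _ fun y => ?_)
    simp only [hm]
    ring
  · intro x
    refine Integrable.const_mul ?_ _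
    refine stdG_int (by fun_prop) K 0 fun y => ?_
    simpa using hmb _

lemma psiF_eq {K : ℝ} (hSK : ∀ x ∈ S, |x| ≤ K) (hS : P ((↑S : Set ℝ)ᶜ) = 0) {s : ℝ}
    (hs : 0 ≤ s) : psiF P (s ^ 2) = PsiS S (fun x => P.real {x}) s := by
  have h := fin_WP P S hSK hS
  set w : ℝ → ℝ := fun x => P.real {x} with hw
  have hlc := logA_cont h s
  have hlb : ∀ y, |Real.log (AA S w 0 s y)| ≤ (s * K + s ^ 2 * K ^ 2 / 2) * Real.exp (1 * |y|) := by
    intro y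
    have h1 := AA_log h (abs_of_nonneg hs).le y
    have h3 : |y| + 1 ≤ Real.exp |y| := Real.add_one_le_exp _
    have h5 : 0 ≤ |y| := abs_nonneg y
    have h6 : 0 ≤ s * K := mul_nonneg hs h.K0
    have h7 : 0 ≤ s ^ 2 * K ^ 2 := by positivity
    rw [one_mul]
    refine h1.trans ?_
    calc _ ≤ (s * K + s ^ 2 * K ^ 2 / 2) * (|y| + 1) := by nlinarith
      _ ≤ _ := by gcongr
  set B := s * K + s ^ 2 * K ^ 2 / 2 with hB
  have hB0 : 0 ≤ B := by have := h.K0; positivity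
  unfold psiF
  simp_rw [den_eq P S hS hs]
  simp_rw [← hw]
  rw [fin_prod P S hS (fun p : ℝ × ℝ => Real.log (AA S w 0 s (s * p.1 + p.2)))]
  · have := shift_sum S 0 w s (fun y => Real.log (AA S w 0 s y)) (fun x => by
      refine stdG_int (by fun_prop) B (|s * x| + 1) fun y => ?_
      rw [abs_mul, abs_of_pos (Real.exp_pos _), mul_comm, add_mul (|s * x|) 1 (|y|),
        add_comm (|s * x| * |y|), Real.exp_add, ← mul_assoc]
      refine mul_le_mul (hlb y) (Real.exp_le_exp.2 ?_) (Real.exp_pos _).le (by positivity)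
      have := le_abs_self (s * x * y)
      rw [abs_mul (s * x)] at this
      have := sq_nonneg (s * x)
      linarith)
    simp only [pow_zero, one_mul] at this
    exact this
  · exact hlc.comp (by fun_prop : Continuous fun p : ℝ × ℝ => s * p.1 + p.2)
  · intro x
    refine stdG_int (hlc.comp (by fun_prop : Continuous fun z : ℝ => s * x + z))
      (B * Real.exp |s * x|) 1 fun z => (hlb _).trans ?_
    rw [mul_assoc, ← Real.exp_add]
    refine mul_le_mul_of_nonneg_left (Real.exp_le_exp.2 ?_) hB0
    have := abs_add_le (s * x) z
    linarith

/-- All facts on the scalar channel needed in the comparison argument. -/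
lemma channel {K : ℝ} (hSK : ∀ x ∈ S, |x| ≤ K) (hS : P ((↑S : Set ℝ)ᶜ) = 0) :
    ∃ ps F : ℝ → ℝ, (∀ a, 0 ≤ a → psiF P a = ps a) ∧ (∀ a, 0 ≤ a → Fov P a = F a) ∧
      (∀ a b, 0 ≤ a → 0 ≤ b → ps a + (b - a) * F a / 2 ≤ ps b) ∧ Monotone F ∧
      (∀ a, 0 ≤ F a) ∧ (∀ a, F a ≤ K ^ 2) ∧ Continuous F ∧ Continuous ps := by
  have h := fin_WP P S hSK hS
  have hc : Continuous (PsiS S fun x => P.real {x}) :=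
    continuous_iff_continuousAt.2 fun u => (PsiS_deriv h u).continuousAt
  refine ⟨fun a => PsiS S (fun x => P.real {x}) (Real.sqrt a),
    fun a => PhiS S (fun x => P.real {x}) (Real.sqrt a), ?_, ?_, ?_, ?_, ?_, ?_, ?_, ?_⟩
  · intro a ha
    have := psiF_eq P S hSK hS (Real.sqrt_nonneg a)
    rwa [Real.sq_sqrt ha] at this
  · intro a ha
    have := Fov_eq P S hSK hS (Real.sqrt_nonneg a)
    rwa [Real.sq_sqrt ha] at this
  · intro a b ha hb
    have := PsiS_subgrad h (Real.sqrt_nonneg a) (Real.sqrt_nonneg b)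
    rwa [Real.sq_sqrt ha, Real.sq_sqrt hb] at this
  · exact fun a b hab => PhiS_mono h (Real.sqrt_nonneg a) (Real.sqrt_le_sqrt hab)
  · exact fun a => PhiS_nonneg h _
  · exact fun a => PhiS_le h _
  · exact (PhiS_cont h).comp Real.continuous_sqrt
  · exact hc.comp Real.continuous_sqrt

end conversion

/-- **Monotonicity of the optimal overlaps** `λ ∈ D ↦ q₁*(λ)` and `λ ∈ D ↦ q₂*(λ)`. -/
theorem optimal_overlaps_monotone
    (K₀ : ℝ) (S : Finset ℝ) (hSK : ∀ x ∈ S, |x| ≤ K₀)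
    (PU PV : Measure ℝ) [IsProbabilityMeasure PU] [IsProbabilityMeasure PV]
    (hUS : PU ((↑S : Set ℝ)ᶜ) = 0) (hVS : PV ((↑S : Set ℝ)ᶜ) = 0)
    (hUvar : 0 < (∫ x, x ^ 2 ∂PU) - (∫ x, x ∂PU) ^ 2)
    (hVvar : 0 < (∫ x, x ^ 2 ∂PV) - (∫ x, x ∂PV) ^ 2) :
    ∀ lam ∈ Dset PU PV, ∀ lam' ∈ Dset PU PV, lam ≤ lam' →
      ∀ q q' : ℝ × ℝ, isMaximizer PU PV lam q → isMaximizer PU PV lam' q' →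
        q.1 ≤ q'.1 ∧ q.2 ≤ q'.2 := by
  intro lam hlam lam' hlam' hle q q' hq hq'
  rcases hle.eq_or_lt with rfl | hlt
  · have := hlam.2.unique hq hq'
    subst this
    exact ⟨le_rfl, le_rfl⟩
  obtain ⟨psU, FU, epU, eU, hU, mU, pU, bU, cU, cpU⟩ := channel PU S hSK hUS
  obtain ⟨psV, FV, epV, eV, hV, mV, pV, bV, cV, cpV⟩ := channel PV S hSK hVS
  have hl : 0 < lam := hlam.1
  have hl' : 0 < lam' := hlam'.1
  have hGam : ∀ l, 0 < l → ∀ p : ℝ × ℝ, p ∈ Gam PU PV l ↔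
      (0 ≤ p.1 ∧ 0 ≤ p.2 ∧ p.2 = FU (l * p.1) ∧ p.1 = FV (l * p.2)) := by
    intro l hl0 p
    unfold Gam
    simp only [Set.mem_setOf_eq]
    constructor
    · rintro ⟨h1, h2, h3, h4⟩
      rw [eU _ (mul_nonneg hl0.le h1)] at h3
      rw [eV _ (mul_nonneg hl0.le h2)] at h4
      exact ⟨h1, h2, h3, h4⟩
    · rintro ⟨h1, h2, h3, h4⟩
      rw [← eU _ (mul_nonneg hl0.le h1)] at h3
      rw [← eV _ (mul_nonneg hl0.le h2)] at h4
      exact ⟨h1, h2, h3, h4⟩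
  have hmax : ∀ l, 0 < l → ∀ p : ℝ × ℝ, isMaximizer PU PV l p → ∀ a b, 0 ≤ a → 0 ≤ b →
      b = FU (l * a) → a = FV (l * b) → psU (l * a) + psV (l * b) - l / 2 * a * b
        ≤ psU (l * p.1) + psV (l * p.2) - l / 2 * p.1 * p.2 := by
    intro l hl0 p hp a b ha hb hab hba
    obtain ⟨g1, g2, -, -⟩ := (hGam l hl0 p).1 hp.1
    have := hp.2 (a, b) ((hGam l hl0 (a, b)).2 ⟨ha, hb, hab, hba⟩)
    unfold rsF at this
    simp only at this
    rwa [epU _ (mul_nonneg hl0.le ha), epV _ (mul_nonneg hl0.le hb),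
      epU _ (mul_nonneg hl0.le g1), epV _ (mul_nonneg hl0.le g2)] at this
  obtain ⟨a1, a2, a3, a4⟩ := (hGam lam hl q).1 hq.1
  obtain ⟨b1, b2, b3, b4⟩ := (hGam lam' hl' q').1 hq'.1
  have h1 : q.1 ≤ q'.1 := absMain psU psV FU FV (K₀ ^ 2) lam lam' hl hlt hU hV mU mV pU pV bU
    cU cV cpU cpV q.1 q.2 q'.1 q'.2 a1 a2 b1 b2 a3 a4 b4 (hmax lam hl q hq)
    (hmax lam' hl' q' hq')
  refine ⟨h1, ?_⟩
  rw [a3, b3]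
  exact mU (mul_le_mul hle h1 a1 hl'.le)
end
end

section
/- Limits of the optimal overlaps: Let D = {λ > 0 : 𝓕(λ,·,·) has a unique maximizer (q₁*(λ), q₂*(λ)) over Γ(λ)}. Then, as λ → 0 along D, q₁*(λ) → (E[V])² and q₂*(λ) → (E[U])²; and as λ → +∞ along D, q₁*(λ) → E[V²] and q₂*(λ) → E[U²], where U ∼ P_U and V ∼ P_V. -/
open MeasureTheory ProbabilityTheory Filter Real
open scoped Topology

noncomputable section

/-- normalized weight -/
def kk (γ x₀ z x : ℝ) : ℝ :=
  Real.exp (Real.sqrt γ * (x - x₀) * z - γ * (x - x₀) ^ 2 / 2)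

lemma sw_eq (γ x₀ z x : ℝ) : scalarWeight γ x₀ z x =
    Real.exp (Real.sqrt γ * x₀ * z + γ * x₀ ^ 2 / 2) * kk γ x₀ z x := by
  unfold scalarWeight kk
  rw [← Real.exp_add]; congr 1; ring

lemma kk_pos (γ x₀ z x : ℝ) : 0 < kk γ x₀ z x := Real.exp_pos _

lemma kk_le (γ x₀ z x : ℝ) (h : 0 ≤ γ) : kk γ x₀ z x ≤ Real.exp (z ^ 2 / 2) := by
  unfold kk
  apply Real.exp_le_exp.2
  have := Real.sq_sqrt h
  nlinarith [sq_nonneg (Real.sqrt γ * (x - x₀) - z)]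

lemma kk_self (γ x₀ z : ℝ) : kk γ x₀ z x₀ = 1 := by simp [kk]

lemma kk_meas (γ : ℝ) : Measurable (fun q : (ℝ × ℝ) × ℝ => kk γ q.1.1 q.1.2 q.2) := by
  unfold kk; fun_prop

lemma kk_meas1 (γ x₀ z : ℝ) : Measurable (kk γ x₀ z) := by
  unfold kk; fun_prop

lemma kk_int (P : Measure ℝ) [IsProbabilityMeasure P] (γ x₀ z : ℝ) (h : 0 ≤ γ) :
    Integrable (kk γ x₀ z) P := by
  refine Integrable.of_bound (kk_meas1 γ x₀ z).aestronglyMeasurable (Real.exp (z ^ 2 / 2)) ?_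
  refine Eventually.of_forall fun x => ?_
  rw [Real.norm_eq_abs, abs_of_pos (kk_pos _ _ _ _)]
  exact kk_le _ _ _ _ h

lemma intkk_pos (P : Measure ℝ) [IsProbabilityMeasure P] (γ x₀ z : ℝ) (h : 0 ≤ γ) :
    0 < ∫ x, kk γ x₀ z x ∂P := by
  rw [integral_pos_iff_support_of_nonneg (fun x => (kk_pos _ _ _ x).le) (kk_int P γ x₀ z h)]
  have : Function.support (kk γ x₀ z) = Set.univ := by
    ext x; simp [(kk_pos γ x₀ z x).ne']
  rw [this]; simp

lemma postMean_eq (P : Measure ℝ) (γ x₀ z : ℝ) :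
    postMean P γ x₀ z = (∫ x, x * kk γ x₀ z x ∂P) / (∫ x, kk γ x₀ z x ∂P) := by
  unfold postMean
  simp_rw [sw_eq γ x₀ z, mul_left_comm _ (Real.exp _)]
  rw [integral_const_mul, integral_const_mul, mul_div_mul_left _ _ (Real.exp_pos _).ne']

lemma postMean_bound (P : Measure ℝ) [IsProbabilityMeasure P] (K : ℝ)
    (hP : ∀ᵐ x ∂P, |x| ≤ K) (γ x₀ z : ℝ) (h : 0 ≤ γ) : |postMean P γ x₀ z| ≤ K := by
  rw [postMean_eq, abs_div, abs_of_pos (intkk_pos P γ x₀ z h), div_le_iff₀ (intkk_pos P γ x₀ z h),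
    ← integral_const_mul, ← Real.norm_eq_abs]
  refine norm_integral_le_of_norm_le ((kk_int P γ x₀ z h).const_mul K) ?_
  filter_upwards [hP] with x hx
  rw [norm_mul, Real.norm_eq_abs, Real.norm_eq_abs, abs_of_pos (kk_pos _ _ _ _)]
  exact mul_le_mul_of_nonneg_right hx (kk_pos _ _ _ _).le

instance : IsProbabilityMeasure stdG := by unfold stdG; infer_instance

lemma ae_fst (P : Measure ℝ) [IsProbabilityMeasure P] {p : ℝ → Prop} (hP : ∀ᵐ x ∂P, p x) :
    ∀ᵐ q ∂(P.prod stdG), p q.1 :=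
  Measure.quasiMeasurePreserving_fst.ae hP

lemma postMean_meas (P : Measure ℝ) [IsProbabilityMeasure P] (γ : ℝ) :
    Measurable (fun p : ℝ × ℝ => postMean P γ p.1 p.2) := by
  simp_rw [postMean_eq]
  have h1 : StronglyMeasurable (fun p : ℝ × ℝ => ∫ x, kk γ p.1 p.2 x ∂P) :=
    (kk_meas γ).stronglyMeasurable.integral_prod_right
  have h2 : StronglyMeasurable (fun p : ℝ × ℝ => ∫ x, x * kk γ p.1 p.2 x ∂P) :=
    StronglyMeasurable.integral_prod_right
      (f := fun (p : ℝ × ℝ) (x : ℝ) => x * kk γ p.1 p.2 x)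
      (measurable_snd.mul (kk_meas γ)).stronglyMeasurable
  exact h2.measurable.div h1.measurable

lemma Fov_bound (P : Measure ℝ) [IsProbabilityMeasure P] (K : ℝ)
    (hP : ∀ᵐ x ∂P, |x| ≤ K) (γ : ℝ) (h : 0 ≤ γ) : |Fov P γ| ≤ K * K := by
  unfold Fov
  rw [← Real.norm_eq_abs]
  have := norm_integral_le_of_norm_le_const (μ := P.prod stdG)
    (f := fun p : ℝ × ℝ => p.1 * postMean P γ p.1 p.2) (C := K * K) ?_
  · simpa using this
  filter_upwards [ae_fst P hP] with p hp
  rw [norm_mul, Real.norm_eq_abs, Real.norm_eq_abs]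
  exact mul_le_mul hp (postMean_bound P K hP γ _ _ h) (abs_nonneg _) ((abs_nonneg _).trans hp)

lemma Fov_tendsto (P : Measure ℝ) [IsProbabilityMeasure P] (K : ℝ)
    (hP : ∀ᵐ x ∂P, |x| ≤ K) (l : Filter ℝ) [l.IsCountablyGenerated] (hl : ∀ᶠ γ in l, 0 ≤ γ)
    (k' : ℝ → ℝ → ℝ → ℝ)
    (hk : ∀ x₀ z x, Tendsto (fun γ => kk γ x₀ z x) l (𝓝 (k' x₀ z x)))
    (hpos : ∀ᵐ x₀ ∂P, ∀ z, ∫ x, k' x₀ z x ∂P ≠ 0) :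
    Tendsto (Fov P) l (𝓝 (∫ p : ℝ × ℝ, p.1 * ((∫ x, x * k' p.1 p.2 x ∂P) /
      (∫ x, k' p.1 p.2 x ∂P)) ∂(P.prod stdG))) := by
  unfold Fov
  refine tendsto_integral_filter_of_dominated_convergence (fun _ => K * K) ?_ ?_ ?_ ?_
  · exact Eventually.of_forall fun γ =>
      (measurable_fst.mul (postMean_meas P γ)).aestronglyMeasurable
  · filter_upwards [hl] with γ h
    filter_upwards [ae_fst P hP] with p hp
    rw [norm_mul, Real.norm_eq_abs, Real.norm_eq_abs]
    exact mul_le_mul hp (postMean_bound P K hP γ _ _ h) (abs_nonneg _) ((abs_nonneg _).trans hp)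
  · exact integrable_const _
  · filter_upwards [ae_fst P hpos] with p hp
    refine Tendsto.const_mul _ ?_
    simp_rw [postMean_eq]
    refine Tendsto.div ?_ ?_ (hp p.2)
    · refine tendsto_integral_filter_of_dominated_convergence
        (fun _ => K * Real.exp (p.2 ^ 2 / 2)) ?_ ?_ ?_ ?_
      · exact Eventually.of_forall fun γ =>
          (measurable_id.mul (kk_meas1 γ p.1 p.2)).aestronglyMeasurable
      · filter_upwards [hl] with γ h
        filter_upwards [hP] with x hx
        rw [norm_mul, Real.norm_eq_abs, Real.norm_eq_abs, abs_of_pos (kk_pos _ _ _ _)]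
        exact mul_le_mul hx (kk_le _ _ _ _ h) (kk_pos _ _ _ _).le ((abs_nonneg _).trans hx)
      · exact integrable_const _
      · exact Eventually.of_forall fun x => (hk _ _ x).const_mul _
    · refine tendsto_integral_filter_of_dominated_convergence
        (fun _ => Real.exp (p.2 ^ 2 / 2)) ?_ ?_ ?_ ?_
      · exact Eventually.of_forall fun γ => (kk_meas1 γ p.1 p.2).aestronglyMeasurable
      · filter_upwards [hl] with γ h
        refine Eventually.of_forall fun x => ?_
        rw [Real.norm_eq_abs, abs_of_pos (kk_pos _ _ _ _)]
        exact kk_le _ _ _ _ h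
      · exact integrable_const _
      · exact Eventually.of_forall fun x => hk _ _ x

lemma Fov_cont (P : Measure ℝ) [IsProbabilityMeasure P] (K : ℝ)
    (hP : ∀ᵐ x ∂P, |x| ≤ K) : ContinuousOn (Fov P) (Set.Ici 0) := by
  intro γ hγ
  have := Fov_tendsto P K hP (𝓝[Set.Ici 0] γ) self_mem_nhdsWithin (kk γ) (fun x₀ z x => ?_)
    (Eventually.of_forall fun x₀ z => (intkk_pos P γ x₀ z hγ).ne')
  · simp_rw [← postMean_eq] at this
    exact this
  · have : Continuous (fun γ => kk γ x₀ z x) := by unfold kk; fun_prop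
    exact this.continuousWithinAt

lemma Fov_zero (P : Measure ℝ) [IsProbabilityMeasure P] : Fov P 0 = (∫ x, x ∂P) ^ 2 := by
  unfold Fov
  have : ∀ p : ℝ × ℝ, postMean P 0 p.1 p.2 = ∫ x, x ∂P := by
    intro p; rw [postMean_eq]; simp [kk]
  simp_rw [this]
  rw [integral_mul_const, sq]
  congr 1
  have := integral_prod_mul (μ := P) (ν := stdG) (fun x : ℝ => x) (fun _ : ℝ => (1 : ℝ))
  simpa using this

lemma atom_pos (P : Measure ℝ) [IsProbabilityMeasure P] (S : Finset ℝ)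
    (hS : P ((↑S : Set ℝ)ᶜ) = 0) : ∀ᵐ x ∂P, x ∈ S ∧ 0 < P.real {x} := by
  have h1 : ∀ᵐ x ∂P, x ∈ S := by
    rw [ae_iff]; exact hS
  have h2 : ∀ s ∈ S, ∀ᵐ x ∂P, x = s → 0 < P.real {x} := by
    intro s _
    by_cases h : P {s} = 0
    · have : ∀ᵐ x ∂P, x ≠ s := by rw [ae_iff]; simpa using h
      filter_upwards [this] with x hx hxs
      exact absurd hxs hx
    · refine Eventually.of_forall fun x hx => ?_
      subst hx
      exact ENNReal.toReal_pos h (measure_ne_top _ _)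
  have h3 := (Finset.eventually_all S).2 h2
  filter_upwards [h1, h3] with x hx h
  exact ⟨hx, h x hx rfl⟩

lemma int_ind (P : Measure ℝ) [IsProbabilityMeasure P] (x₀ : ℝ) (c : ℝ → ℝ) :
    ∫ x, c x * (if x = x₀ then 1 else 0) ∂P = c x₀ * P.real {x₀} := by
  have : ∀ x, c x * (if x = x₀ then (1:ℝ) else 0) = Set.indicator {x₀} (fun _ => c x₀) x := by
    intro x
    by_cases h : x = x₀ <;> simp [h]
  simp_rw [this]
  rw [integral_indicator (measurableSet_singleton _)]
  simp [mul_comm, Measure.real]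

lemma kk_lim (x₀ z x : ℝ) : Tendsto (fun γ => kk γ x₀ z x) atTop
    (𝓝 (if x = x₀ then 1 else 0)) := by
  by_cases h : x = x₀
  · simp [h, kk_self]
  simp only [h, if_false]
  unfold kk
  refine Real.tendsto_exp_atBot.comp ?_
  have hd : 0 < (x - x₀) ^ 2 := by positivity [sub_ne_zero.2 h]
  have h1 : Tendsto (fun γ : ℝ => Real.sqrt γ * (Real.sqrt γ * (-((x - x₀) ^ 2 / 2)) + (x - x₀) * z))
      atTop atBot := by
    refine Tendsto.atTop_mul_atBot₀ Real.tendsto_sqrt_atTop ?_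
    refine tendsto_atBot_add_const_right _ _ ?_
    exact Real.tendsto_sqrt_atTop.atTop_mul_const_of_neg (by linarith)
  refine h1.congr' ?_
  filter_upwards [eventually_ge_atTop 0] with γ hγ
  have := Real.mul_self_sqrt hγ
  linear_combination (-(x - x₀) ^ 2 / 2) * this

lemma Fov_lim (P : Measure ℝ) [IsProbabilityMeasure P] (K : ℝ) (S : Finset ℝ)
    (hP : ∀ᵐ x ∂P, |x| ≤ K) (hS : P ((↑S : Set ℝ)ᶜ) = 0) :
    Tendsto (Fov P) atTop (𝓝 (∫ x, x ^ 2 ∂P)) := by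
  have hi : ∀ x₀ : ℝ, ∫ x, (if x = x₀ then (1:ℝ) else 0) ∂P = P.real {x₀} := by
    intro x₀; simpa using int_ind P x₀ (fun _ => 1)
  have h := Fov_tendsto P K hP atTop (eventually_ge_atTop 0) (fun x₀ _ x => if x = x₀ then 1 else 0)
    kk_lim (by
      filter_upwards [atom_pos P S hS] with x hx z
      rw [hi]; exact hx.2.ne')
  convert h using 2
  have : ∫ p : ℝ × ℝ, p.1 ^ 2 ∂(P.prod stdG) = ∫ x, x ^ 2 ∂P := by
    have := integral_prod_mul (μ := P) (ν := stdG) (fun x : ℝ => x ^ 2) (fun _ : ℝ => (1 : ℝ))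
    simpa using this
  rw [← this]
  refine integral_congr_ae ?_
  filter_upwards [ae_fst P (atom_pos P S hS)] with p hp
  rw [int_ind P p.1 (fun x => x), hi, mul_div_cancel_right₀ _ hp.2.ne', sq]

lemma stdG_sq : Integrable (fun z : ℝ => z ^ 2) stdG := by
  have := (memLp_id_gaussianReal (μ := 0) (v := 1) 2).integrable_sq
  simpa [stdG] using this

lemma stdG_id : Integrable (fun z : ℝ => z) stdG := by
  have := (memLp_id_gaussianReal (μ := 0) (v := 1) 1)
  simp only [ENNReal.coe_one] at this
  exact memLp_one_iff_integrable.1 this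

lemma psi_bound (P : Measure ℝ) [IsProbabilityMeasure P] (K : ℝ) (S : Finset ℝ)
    (hP : ∀ᵐ x ∂P, |x| ≤ K) (hS : P ((↑S : Set ℝ)ᶜ) = 0) :
    ∃ C, ∀ γ, 0 ≤ γ → |psiF P γ - γ / 2 * ∫ x, x ^ 2 ∂P| ≤ C := by
  set c : ℝ := ∑ s ∈ S, |Real.log (P.real {s})| with hc
  have hint : Integrable (fun p : ℝ × ℝ => c + p.2 ^ 2 / 2) (P.prod stdG) :=
    (integrable_const c).add ((stdG_sq.comp_snd P).div_const 2)
  refine ⟨∫ p : ℝ × ℝ, (c + p.2 ^ 2 / 2) ∂(P.prod stdG), fun γ hγ => ?_⟩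
  have hlog : ∀ᵐ p ∂(P.prod stdG),
      ‖Real.log (∫ x, kk γ p.1 p.2 x ∂P)‖ ≤ c + p.2 ^ 2 / 2 := by
    filter_upwards [ae_fst P (atom_pos P S hS)] with p hp
    have hpos := intkk_pos P γ p.1 p.2 hγ
    have hc1 : |Real.log (P.real {p.1})| ≤ c :=
      Finset.single_le_sum (f := fun s => |Real.log (P.real {s})|) (fun _ _ => abs_nonneg _) hp.1
    have hup : ∫ x, kk γ p.1 p.2 x ∂P ≤ Real.exp (p.2 ^ 2 / 2) := by
      have := integral_mono (kk_int P γ p.1 p.2 hγ) (integrable_const (Real.exp (p.2 ^ 2 / 2)))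
        (fun x => kk_le γ p.1 p.2 x hγ)
      simpa using this
    have hlo : P.real {p.1} ≤ ∫ x, kk γ p.1 p.2 x ∂P := by
      have h0 := int_ind P p.1 (fun x => kk γ p.1 p.2 x)
      rw [kk_self, one_mul] at h0
      rw [← h0]
      refine integral_mono_of_nonneg ?_ (kk_int P γ p.1 p.2 hγ) ?_
      · refine Eventually.of_forall fun x => ?_
        have := (kk_pos γ p.1 p.2 x).le
        dsimp only [Pi.zero_apply]
        split_ifs <;> simp [this]
      · refine Eventually.of_forall fun x => ?_
        have := (kk_pos γ p.1 p.2 x).le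
        dsimp only
        split_ifs <;> simp [this]
    have h1 := Real.log_le_log hpos hup
    rw [Real.log_exp] at h1
    have h2 := Real.log_le_log hp.2 hlo
    rw [Real.norm_eq_abs, abs_le]
    have := abs_le.1 hc1
    have := abs_nonneg (Real.log (P.real {p.1}))
    constructor <;> nlinarith [sq_nonneg p.2]
  have hmeas : AEStronglyMeasurable (fun p : ℝ × ℝ => Real.log (∫ x, kk γ p.1 p.2 x ∂P))
      (P.prod stdG) := by
    have h1 : StronglyMeasurable (fun p : ℝ × ℝ => ∫ x, kk γ p.1 p.2 x ∂P) :=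
      (kk_meas γ).stronglyMeasurable.integral_prod_right
    exact (Real.measurable_log.comp h1.measurable).aestronglyMeasurable
  have hlint : Integrable (fun p : ℝ × ℝ => Real.log (∫ x, kk γ p.1 p.2 x ∂P)) (P.prod stdG) :=
    hint.mono' hmeas hlog
  have hxint : Integrable (fun x : ℝ => x) P :=
    Integrable.of_bound measurable_id.aestronglyMeasurable K hP
  have hx2int : Integrable (fun x : ℝ => x ^ 2) P := by
    refine Integrable.of_bound (measurable_id.pow_const 2).aestronglyMeasurable (K ^ 2) ?_
    filter_upwards [hP] with x hx
    rw [norm_pow]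
    exact pow_le_pow_left₀ (norm_nonneg _) hx 2
  have i1 : Integrable (fun p : ℝ × ℝ => Real.sqrt γ * (p.1 * p.2)) (P.prod stdG) :=
    (hxint.mul_prod stdG_id).const_mul _
  have i2 : Integrable (fun p : ℝ × ℝ => γ / 2 * p.1 ^ 2) (P.prod stdG) :=
    (hx2int.comp_fst stdG).const_mul _
  have key : psiF P γ = γ / 2 * ∫ x, x ^ 2 ∂P +
      ∫ p : ℝ × ℝ, Real.log (∫ x, kk γ p.1 p.2 x ∂P) ∂(P.prod stdG) := by
    unfold psiF
    have e : ∀ p : ℝ × ℝ, Real.log (∫ x, scalarWeight γ p.1 p.2 x ∂P) =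
        Real.sqrt γ * (p.1 * p.2) + γ / 2 * p.1 ^ 2 + Real.log (∫ x, kk γ p.1 p.2 x ∂P) := by
      intro p
      simp_rw [sw_eq γ p.1 p.2]
      rw [integral_const_mul, Real.log_mul (Real.exp_pos _).ne' (intkk_pos P γ _ _ hγ).ne',
        Real.log_exp]
      ring
    simp_rw [e]
    have i12 : Integrable (fun p : ℝ × ℝ => Real.sqrt γ * (p.1 * p.2) + γ / 2 * p.1 ^ 2)
        (P.prod stdG) := i1.add i2
    rw [integral_add i12 hlint, integral_add i1 i2, integral_const_mul, integral_const_mul]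
    have a1 : ∫ p : ℝ × ℝ, p.1 * p.2 ∂(P.prod stdG) = 0 := by
      have := integral_prod_mul (μ := P) (ν := stdG) (fun x : ℝ => x) (fun z : ℝ => z)
      rw [this]
      have : ∫ z, z ∂stdG = 0 := by simpa [stdG] using integral_id_gaussianReal (μ := 0) (v := 1)
      rw [this, mul_zero]
    have a2 : ∫ p : ℝ × ℝ, p.1 ^ 2 ∂(P.prod stdG) = ∫ x, x ^ 2 ∂P := by
      have := integral_prod_mul (μ := P) (ν := stdG) (fun x : ℝ => x ^ 2) (fun _ : ℝ => (1 : ℝ))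
      simpa using this
    rw [a1, a2]; ring
  rw [key, add_sub_cancel_left, ← Real.norm_eq_abs]
  exact norm_integral_le_of_norm_le hint hlog

/-- **Limits of the optimal overlaps** as `λ → 0` and `λ → +∞` along `D`:
`q₁*(λ) → (E[V])²`, `q₂*(λ) → (E[U])²` as `λ → 0`, and
`q₁*(λ) → E[V²]`, `q₂*(λ) → E[U²]` as `λ → +∞`. -/
theorem optimal_overlaps_limits
    (K₀ : ℝ) (S : Finset ℝ) (hSK : ∀ x ∈ S, |x| ≤ K₀)
    (PU PV : Measure ℝ) [IsProbabilityMeasure PU] [IsProbabilityMeasure PV]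
    (hUS : PU ((↑S : Set ℝ)ᶜ) = 0) (hVS : PV ((↑S : Set ℝ)ᶜ) = 0)
    (hUvar : 0 < (∫ x, x ^ 2 ∂PU) - (∫ x, x ∂PU) ^ 2)
    (hVvar : 0 < (∫ x, x ^ 2 ∂PV) - (∫ x, x ∂PV) ^ 2) :
    (∀ ε > (0 : ℝ), ∃ δ > (0 : ℝ), ∀ lam ∈ Dset PU PV, lam < δ →
        ∀ q : ℝ × ℝ, isMaximizer PU PV lam q →
          |q.1 - (∫ x, x ∂PV) ^ 2| < ε ∧ |q.2 - (∫ x, x ∂PU) ^ 2| < ε)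
    ∧ (∀ ε > (0 : ℝ), ∃ M : ℝ, ∀ lam ∈ Dset PU PV, M < lam →
        ∀ q : ℝ × ℝ, isMaximizer PU PV lam q →
          |q.1 - ∫ x, x ^ 2 ∂PV| < ε ∧ |q.2 - ∫ x, x ^ 2 ∂PU| < ε) := by
  have hK : ∀ (P : Measure ℝ), P ((↑S : Set ℝ)ᶜ) = 0 → ∀ᵐ x ∂P, |x| ≤ |K₀| := by
    intro P h
    have h1 : ∀ᵐ x ∂P, x ∈ S := by rw [ae_iff]; exact h
    filter_upwards [h1] with x hx
    exact (hSK x hx).trans (le_abs_self _)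
  have hKU := hK PU hUS
  have hKV := hK PV hVS
  generalize |K₀| = K at hKU hKV
  have hcU := Fov_cont PU K hKU
  have hcV := Fov_cont PV K hKV
  constructor
  · intro ε hε
    have aux : ∀ (P : Measure ℝ) [IsProbabilityMeasure P], ContinuousOn (Fov P) (Set.Ici 0) →
        ∃ δ > 0, ∀ γ, 0 ≤ γ → γ < δ → |Fov P γ - (∫ x, x ∂P) ^ 2| < ε := by
      intro P _ hc
      obtain ⟨δ, hδ, h⟩ := Metric.continuousOn_iff.1 hc 0 (by simp) ε hε
      refine ⟨δ, hδ, fun γ h0 h1 => ?_⟩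
      have := h γ h0 (by rwa [Real.dist_eq, sub_zero, abs_of_nonneg h0])
      rwa [Real.dist_eq, Fov_zero] at this
    obtain ⟨δ₁, hδ₁, h₁⟩ := aux PU hcU
    obtain ⟨δ₂, hδ₂, h₂⟩ := aux PV hcV
    have hpos : 0 < K * K + 1 := by nlinarith [sq_nonneg K]
    refine ⟨min δ₁ δ₂ / (K * K + 1), div_pos (lt_min hδ₁ hδ₂) hpos, ?_⟩
    rintro lam ⟨hlam, -⟩ hlt q ⟨⟨hq1, hq2, e2, e1⟩, -⟩
    have n1 : 0 ≤ lam * q.1 := by positivity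
    have n2 : 0 ≤ lam * q.2 := by positivity
    have b1 : q.1 ≤ K * K := by
      have := Fov_bound PV K hKV _ n2
      rw [← e1] at this
      exact (le_abs_self _).trans this
    have b2 : q.2 ≤ K * K := by
      have := Fov_bound PU K hKU _ n1
      rw [← e2] at this
      exact (le_abs_self _).trans this
    rw [lt_div_iff₀ hpos] at hlt
    have l1 := min_le_left δ₁ δ₂
    have l2 := min_le_right δ₁ δ₂
    constructor
    · have := h₂ _ n2 (by nlinarith)
      rwa [← e1] at this
    · have := h₁ _ n1 (by nlinarith)
      rwa [← e2] at this
  · intro ε hε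
    have limU := Fov_lim PU K S hKU hUS
    have limV := Fov_lim PV K S hKV hVS
    obtain ⟨C₁, hC₁⟩ := psi_bound PU K S hKU hUS
    obtain ⟨C₂, hC₂⟩ := psi_bound PV K S hKV hVS
    have hA : 0 < ∫ x, x ^ 2 ∂PU := by nlinarith [sq_nonneg (∫ x, x ∂PU)]
    have hB : 0 < ∫ x, x ^ 2 ∂PV := by nlinarith [sq_nonneg (∫ x, x ∂PV)]
    generalize (∫ x, x ^ 2 ∂PU) = A at *
    generalize (∫ x, x ^ 2 ∂PV) = B at *
    obtain ⟨e, he, heε, heA, heB, he1⟩ : ∃ e > 0, e ≤ ε ∧ e ≤ A / 4 ∧ e ≤ B / 4 ∧ e ≤ 1 / 2 :=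
      ⟨min ε (min (A / 4) (min (B / 4) (1 / 2))), by positivity, by simp, by simp, by simp, by simp⟩
    have ev : ∀ᶠ γ in atTop, |Fov PU γ - A| < e ∧ |Fov PV γ - B| < e :=
      (limU.eventually (Metric.ball_mem_nhds A he)).and
        (limV.eventually (Metric.ball_mem_nhds B he))
    obtain ⟨R, hR⟩ := eventually_atTop.1 ev
    have hbig : ∀ᶠ lam : ℝ in atTop, R ≤ lam * (B / 2) ∧ R ≤ lam * (A / 2) ∧
        4 * (C₁ + C₂) < lam * (A * B / 16) :=
      ((tendsto_id.atTop_mul_const (by positivity)).eventually_ge_atTop R).and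
        (((tendsto_id.atTop_mul_const (by positivity)).eventually_ge_atTop R).and
        ((tendsto_id.atTop_mul_const (by positivity)).eventually_gt_atTop _))
    obtain ⟨M, hM⟩ := eventually_atTop.1 hbig
    refine ⟨M, ?_⟩
    rintro lam ⟨hlam, -⟩ hlt q ⟨⟨hq1, hq2, e2, e1⟩, hmax⟩
    obtain ⟨m1, m2, m3⟩ := hM lam hlt.le
    have stepU : ∀ t, B / 2 ≤ t → |Fov PU (lam * t) - A| < e := fun t ht =>
      (hR _ (m1.trans (mul_le_mul_of_nonneg_left ht hlam.le))).1
    have stepV : ∀ t, A / 2 ≤ t → |Fov PV (lam * t) - B| < e := fun t ht =>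
      (hR _ (m2.trans (mul_le_mul_of_nonneg_left ht hlam.le))).2
    have lowU : ∀ t, B / 2 ≤ t → A / 2 ≤ Fov PU (lam * t) := fun t ht => by
      have := abs_lt.1 (stepU t ht); linarith
    have lowV : ∀ t, A / 2 ≤ t → B / 2 ≤ Fov PV (lam * t) := fun t ht => by
      have := abs_lt.1 (stepV t ht); linarith
    have expand : ∀ a b : ℝ, 0 ≤ a → 0 ≤ b →
        |rsF PU PV lam a b - lam / 2 * (A * B - (A - b) * (B - a))| ≤ C₁ + C₂ := by
      intro a b ha hb
      have h1 := abs_le.1 (hC₁ (lam * a) (by positivity))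
      have h2 := abs_le.1 (hC₂ (lam * b) (by positivity))
      unfold rsF
      rw [abs_le]
      constructor <;> nlinarith
    -- competitor
    have hcont : ContinuousOn (fun t => Fov PV (lam * Fov PU (lam * t)) - t)
        (Set.Icc (B / 2) (B + 1)) := by
      refine ContinuousOn.sub ?_ continuousOn_id
      refine hcV.comp (continuousOn_const.mul
        (hcU.comp (continuousOn_const.mul continuousOn_id) ?_)) ?_
      · intro t ht
        have : 0 ≤ t := by linarith [ht.1]
        exact mul_nonneg hlam.le this
      · intro t ht
        exact mul_nonneg hlam.le (by linarith [lowU t ht.1])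
    have hivt := intermediate_value_Icc' (by linarith : B / 2 ≤ B + 1) hcont
    obtain ⟨t, ht, hz⟩ := hivt (show (0 : ℝ) ∈ _ by
      have g1 := abs_lt.1 (stepV _ (lowU (B / 2) le_rfl))
      have g2 := abs_lt.1 (stepV _ (lowU (B + 1) (by linarith)))
      constructor <;> linarith)
    have hu := lowU t ht.1
    have hfix : t = Fov PV (lam * Fov PU (lam * t)) := by
      have : Fov PV (lam * Fov PU (lam * t)) - t = 0 := hz
      linarith
    have ht0 : 0 ≤ t := by linarith [ht.1]
    have hu0 : 0 ≤ Fov PU (lam * t) := by linarith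
    have hcomp := hmax (t, Fov PU (lam * t)) ⟨ht0, hu0, rfl, hfix⟩
    have x1 := abs_le.1 (expand _ _ ht0 hu0)
    have x2 := abs_le.1 (expand _ _ hq1 hq2)
    have y1 := stepU t ht.1
    have y2 := stepV _ hu
    rw [← hfix] at y2
    have prod : (A - Fov PU (lam * t)) * (B - t) ≤ A * B / 16 := by
      calc _ ≤ |(A - Fov PU (lam * t)) * (B - t)| := le_abs_self _
        _ = |Fov PU (lam * t) - A| * |t - B| := by
            rw [abs_mul, abs_sub_comm A, abs_sub_comm B]
        _ ≤ (A / 4) * (B / 4) :=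
            mul_le_mul (by linarith) (by linarith) (abs_nonneg _) (by linarith)
        _ = _ := by ring
    have final : (A - q.2) * (B - q.1) < A * B / 4 := by
      dsimp only at hcomp
      have h5 : lam * ((A - q.2) * (B - q.1)) ≤
          lam * ((A - Fov PU (lam * t)) * (B - t)) + 4 * (C₁ + C₂) := by
        nlinarith
      have h6 := mul_le_mul_of_nonneg_left prod hlam.le
      have hAB : 0 < A * B := by positivity
      refine lt_of_mul_lt_mul_left (a := lam) ?_ hlam.le
      nlinarith [mul_pos hlam hAB]
    have concl : B / 2 ≤ q.1 ∧ A / 2 ≤ q.2 := by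
      by_cases h : B / 2 ≤ q.1
      · exact ⟨h, e2 ▸ lowU _ h⟩
      · have h' : A / 2 ≤ q.2 := by
          by_contra h'
          push Not at h h'
          nlinarith [mul_pos (sub_pos.2 h) (sub_pos.2 h')]
        exact ⟨e1 ▸ lowV _ h', h'⟩
    have r1 := stepU _ concl.1
    have r2 := stepV _ concl.2
    rw [← e2] at r1
    rw [← e1] at r2
    exact ⟨r2.trans_le heε, r1.trans_le heε⟩
end
end

section
/- Derivative of the free energy and I-MMSE relation: The map λ ↦ F_n(λ) is convex and differentiable on (0,∞), and for every λ > 0, F_n'(λ) = (1/2)·E⟨(u·U)(v·V)⟩, where (u,v) is a sample from the posterior Gibbs measure ⟨·⟩. Consequently MMSE_n(λ) = ((n−1)/n)·E[U²]·E[V²] + (1/n)·E[U²]·E[V²] evaluated for a single pair, i.e. MMSE_n(λ) = ((n−1)/n)·E[U²]·E[V²] + (1/n)·E[U²·V²] − 2·F_n'(λ), where (U,V) ∼ P₀. -/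
open MeasureTheory ProbabilityTheory Filter Real
open scoped Topology

noncomputable section

section gauss
variable {κ : Type*} [Fintype κ]

/-- Standard Gaussian measure on `κ → ℝ`. -/
def gpi (κ : Type*) [Fintype κ] : Measure (κ → ℝ) := Measure.pi fun _ => stdG

instance gpi_prob : IsProbabilityMeasure (gpi κ) := by unfold gpi; infer_instance

lemma stdG_shift_s8 (a : ℝ) :
    stdG.map (fun t => t + a) = stdG.withDensity (fun t => ENNReal.ofReal (exp (a * t - a * a / 2))) := by
  unfold stdG
  rw [gaussianReal_map_add_const, gaussianReal_of_var_ne_zero _ one_ne_zero,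
    gaussianReal_of_var_ne_zero _ one_ne_zero, ← withDensity_mul _ (measurable_gaussianPDF _ _)
      (by fun_prop)]
  congr 1
  ext t
  simp only [gaussianPDF, gaussianPDFReal, Pi.mul_apply]
  rw [← ENNReal.ofReal_mul (by positivity), mul_assoc (√(2 * π * ((1 : NNReal) : ℝ)))⁻¹, ← Real.exp_add]
  congr 3
  simp
  ring

lemma stdG_integrable_exp (a : ℝ) : Integrable (fun t => exp (a * t - a * a / 2)) stdG := by
  unfold stdG
  simp_rw [sub_eq_add_neg, Real.exp_add]
  exact (integrable_exp_mul_gaussianReal a).mul_const _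

lemma gpi_shift (a : κ → ℝ) :
    (gpi κ).map (fun g => g + a)
      = (gpi κ).withDensity (fun g => ENNReal.ofReal (exp (a ⬝ᵥ g - a ⬝ᵥ a / 2))) := by
  have h1 : (gpi κ).map (fun g => g + a)
      = Measure.pi (fun k => stdG.map (fun t => t + a k)) := by
    unfold gpi
    have : ∀ k, SigmaFinite (stdG.map (fun t => t + a k)) := fun k => by
      have := Measure.isProbabilityMeasure_map (μ := stdG) (f := fun t => t + a k) (by fun_prop)
      infer_instance
    exact Measure.pi_map_pi (μ := fun _ : κ => stdG) (f := fun k t => t + a k) (fun k => by fun_prop)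
  rw [h1]
  have : ∀ k, SigmaFinite (stdG.map (fun t => t + a k)) := fun k => by
    have := Measure.isProbabilityMeasure_map (μ := stdG) (f := fun t => t + a k) (by fun_prop)
    infer_instance
  symm
  refine (Measure.pi_eq fun s hs => ?_).symm
  rw [withDensity_apply _ (MeasurableSet.univ_pi hs)]
  unfold gpi
  rw [Measure.restrict_pi_pi]
  have hprod : ∀ g : κ → ℝ, exp (a ⬝ᵥ g - a ⬝ᵥ a / 2) = ∏ k, exp (a k * g k - a k * a k / 2) := by
    intro g
    rw [← Real.exp_sum]
    congr 1
    simp only [dotProduct, Finset.sum_sub_distrib, Finset.sum_div]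
  simp_rw [hprod]
  rw [← ofReal_integral_eq_lintegral_ofReal, integral_fintype_prod_eq_prod (fun k t => exp (a k * t - a k * a k / 2)),
    ENNReal.ofReal_prod_of_nonneg]
  · refine Finset.prod_congr rfl fun k _ => ?_
    rw [stdG_shift_s8, withDensity_apply _ (hs k), ofReal_integral_eq_lintegral_ofReal]
    · exact (stdG_integrable_exp _).restrict
    · exact Eventually.of_forall fun t => (exp_pos _).le
  · intro k _
    exact integral_nonneg fun t => (exp_pos _).le
  · exact Integrable.fintype_prod (f := fun k t => exp (a k * t - a k * a k / 2))
      (fun k => (stdG_integrable_exp _).restrict)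
  · exact Eventually.of_forall fun t => Finset.prod_nonneg fun k _ => (exp_pos _).le

lemma gpi_cm (a : κ → ℝ) (φ : (κ → ℝ) → ℝ) :
    ∫ g, φ (g + a) ∂(gpi κ) = ∫ g, φ g * exp (a ⬝ᵥ g - a ⬝ᵥ a / 2) ∂(gpi κ) := by
  have h := (MeasurableEquiv.addRight a).measurableEmbedding.integral_map (μ := gpi κ) φ
  simp only [MeasurableEquiv.coe_addRight] at h
  rw [← h, gpi_shift, integral_withDensity_eq_integral_toReal_smul]
  · refine integral_congr_ae (Eventually.of_forall fun g => ?_)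
    simp only [smul_eq_mul]
    rw [ENNReal.toReal_ofReal (exp_pos _).le, mul_comm]
  · simp only [dotProduct]; fun_prop
  · exact Eventually.of_forall fun g => ENNReal.ofReal_lt_top

lemma gpi_cm_integrable (a : κ → ℝ) (φ : (κ → ℝ) → ℝ) :
    Integrable (fun g => φ (g + a)) (gpi κ) ↔
      Integrable (fun g => φ g * exp (a ⬝ᵥ g - a ⬝ᵥ a / 2)) (gpi κ) := by
  have h := (MeasurableEquiv.addRight a).measurableEmbedding.integrable_map_iff (μ := gpi κ) (g := φ)
  simp only [MeasurableEquiv.coe_addRight] at h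
  change Integrable (φ ∘ (fun x => x + a)) (gpi κ) ↔ _
  rw [← h, gpi_shift, integrable_withDensity_iff_integrable_smul']
  · refine integrable_congr (Eventually.of_forall fun g => ?_)
    simp only [smul_eq_mul]
    rw [ENNReal.toReal_ofReal (exp_pos _).le, mul_comm]
  · simp only [dotProduct]; fun_prop
  · exact Eventually.of_forall fun g => ENNReal.ofReal_lt_top

lemma gpi_exp_integrable (a : κ → ℝ) :
    Integrable (fun g => exp (a ⬝ᵥ g - a ⬝ᵥ a / 2)) (gpi κ) := by
  have := (gpi_cm_integrable a (fun _ => 1)).1 (integrable_const _)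
  simpa using this

lemma gpi_exp_integral (a : κ → ℝ) :
    ∫ g, exp (a ⬝ᵥ g - a ⬝ᵥ a / 2) ∂(gpi κ) = 1 := by
  have := gpi_cm a (fun _ => 1)
  simp at this
  exact this.symm

lemma stdG_conv {γ δ : ℝ} (hγ : 0 ≤ γ) (hδ : 0 ≤ δ) :
    (stdG.prod stdG).map (fun p => √γ * p.1 + √δ * p.2) = stdG.map (fun t => √(γ + δ) * t) := by
  have h := gaussianReal_conv_gaussianReal (m₁ := 0) (m₂ := 0) (v₁ := γ.toNNReal) (v₂ := δ.toNNReal)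
  have e : ∀ c : ℝ, 0 ≤ c → stdG.map (fun t => √c * t) = gaussianReal 0 c.toNNReal := by
    intro c hc
    unfold stdG
    rw [gaussianReal_map_const_mul]
    congr 1
    · simp
    · ext; simp [hc]
  rw [e _ (add_nonneg hγ hδ), Real.toNNReal_add hγ hδ, ← zero_add (0:ℝ), ← h, ← e γ hγ, ← e δ hδ,
    Measure.conv, Measure.map_prod_map _ _ (by fun_prop) (by fun_prop),
    Measure.map_map (by fun_prop) (by fun_prop)]
  rfl

lemma gpi_conv {γ δ : ℝ} (hγ : 0 ≤ γ) (hδ : 0 ≤ δ) :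
    ((gpi κ).prod (gpi κ)).map (fun p => √γ • p.1 + √δ • p.2)
      = (gpi κ).map (fun g => √(γ + δ) • g) := by
  unfold gpi
  have h := (measurePreserving_arrowProdEquivProdArrow ℝ ℝ κ (fun _ => stdG) (fun _ => stdG)).map_eq
  rw [← h, Measure.map_map (by fun_prop) (by fun_prop)]
  have s1 : SigmaFinite ((stdG.prod stdG).map (fun p => √γ * p.1 + √δ * p.2)) := by
    have := Measure.isProbabilityMeasure_map (μ := stdG.prod stdG)
      (f := fun p => √γ * p.1 + √δ * p.2) (by fun_prop)
    infer_instance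
  have s2 : SigmaFinite (stdG.map (fun t => √(γ + δ) * t)) := by
    have := Measure.isProbabilityMeasure_map (μ := stdG)
      (f := fun t => √(γ + δ) * t) (by fun_prop)
    infer_instance
  have a1 := Measure.pi_map_pi (ι := κ) (μ := fun _ => stdG.prod stdG)
    (f := fun _ p => √γ * p.1 + √δ * p.2) (fun k => by fun_prop)
  have a2 := Measure.pi_map_pi (ι := κ) (μ := fun _ => stdG)
    (f := fun _ t => √(γ + δ) * t) (fun k => by fun_prop)
  simp only [stdG_conv hγ hδ] at a1
  exact a1.trans a2.symm

lemma gpi_integrable_eval (k : κ) : Integrable (fun g : κ → ℝ => g k) (gpi κ) := by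
  have : Integrable (id : ℝ → ℝ) stdG :=
    memLp_one_iff_integrable.1 (memLp_id_gaussianReal' 1 (by simp))
  exact integrable_comp_eval (μ := fun _ : κ => stdG) (i := k) this

lemma gpi_integral_eval (k : κ) : ∫ g : κ → ℝ, g k ∂(gpi κ) = 0 := by
  have : Integrable (id : ℝ → ℝ) stdG :=
    memLp_one_iff_integrable.1 (memLp_id_gaussianReal' 1 (by simp))
  have h := integral_comp_eval (μ := fun _ : κ => stdG) (i := k) (f := id) (by
    exact this.aestronglyMeasurable)
  unfold gpi
  rw [show (∫ g : κ → ℝ, g k ∂(Measure.pi fun _ => stdG)) = _ from h]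
  exact integral_id_gaussianReal

lemma gpi_integral_dot (a : κ → ℝ) : ∫ g : κ → ℝ, a ⬝ᵥ g ∂(gpi κ) = 0 := by
  simp only [dotProduct]
  rw [integral_finsetSum _ (fun k _ => (gpi_integrable_eval k).const_mul _)]
  simp [integral_const_mul, gpi_integral_eval]

lemma gpi_integrable_dot (a : κ → ℝ) : Integrable (fun g : κ → ℝ => a ⬝ᵥ g) (gpi κ) := by
  simp only [dotProduct]
  exact integrable_finsetSum _ (fun k _ => (gpi_integrable_eval k).const_mul _)

lemma gpi_integrable_norm : Integrable (fun g : κ → ℝ => ‖g‖) (gpi κ) := by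
  refine Integrable.mono' (g := fun g => ∑ k, |g k|)
    (integrable_finsetSum _ fun k _ => (gpi_integrable_eval k).abs)
    continuous_norm.aestronglyMeasurable (Eventually.of_forall fun g => ?_)
  rw [norm_norm]
  refine (pi_norm_le_iff_of_nonneg (Finset.sum_nonneg fun k _ => abs_nonneg _)).2 fun k => ?_
  exact Finset.single_le_sum (f := fun k => |g k|) (fun k _ => abs_nonneg _) (Finset.mem_univ k)

end gauss

lemma noise_eq (n : ℕ) : (Measure.pi fun _ : Fin n => Measure.pi fun _ : Fin n => stdG)
    = (gpi (Fin n × Fin n)).map (MeasurableEquiv.curry (Fin n) (Fin n) ℝ) := by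
  unfold gpi
  have h := Measure.infinitePi_map_curry (ι := Fin n) (κ := Fin n) (X := ℝ) (μ := fun _ _ => stdG)
  simp only [Measure.infinitePi_eq_pi] at h
  exact h.symm
set_option linter.unusedSectionVars false
set_option linter.unusedVariables false

section channel
variable {κ ι : Type*} [Fintype κ] [Fintype ι]

/-- Likelihood ratio of the signal `x i` given the observation `y`. -/
def ew (x : ι → κ → ℝ) (γ : ℝ) (i : ι) (y : κ → ℝ) : ℝ := exp (x i ⬝ᵥ y - γ * (x i ⬝ᵥ x i) / 2)

/-- Partition function. -/
def zf (w : ι → ℝ) (x : ι → κ → ℝ) (γ : ℝ) (y : κ → ℝ) : ℝ := ∑ i, w i * ew x γ i y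

/-- Posterior bracket. -/
def br (w : ι → ℝ) (x : ι → κ → ℝ) (γ : ℝ) (f : ι → ℝ) (y : κ → ℝ) : ℝ :=
  (∑ i, w i * (f i * ew x γ i y)) / zf w x γ y

/-- Observation. -/
def Wf (x : ι → κ → ℝ) (γ : ℝ) (i : ι) (g : κ → ℝ) : κ → ℝ := γ • x i + √γ • g

lemma ew_pos (x : ι → κ → ℝ) (γ : ℝ) (i : ι) (y : κ → ℝ) : 0 < ew x γ i y := exp_pos _

lemma dot_continuous (a : κ → ℝ) : Continuous (fun y : κ → ℝ => a ⬝ᵥ y) := by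
  simp only [dotProduct]; fun_prop

lemma ew_continuous (x : ι → κ → ℝ) (γ : ℝ) (i : ι) : Continuous (ew x γ i) := by
  unfold ew
  have := dot_continuous (x i)
  fun_prop

lemma Wf_continuous (x : ι → κ → ℝ) (γ : ℝ) (i : ι) : Continuous (Wf x γ i) := by
  unfold Wf; fun_prop

lemma zf_continuous (w : ι → ℝ) (x : ι → κ → ℝ) (γ : ℝ) : Continuous (zf w x γ) := by
  unfold zf
  have := ew_continuous x γ
  fun_prop

lemma zf_pos {w : ι → ℝ} (x : ι → κ → ℝ) (γ : ℝ) (hw : ∀ i, 0 ≤ w i) (hw1 : ∑ i, w i = 1)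
    (y : κ → ℝ) : 0 < zf w x γ y := by
  unfold zf
  have h0 : ∀ i ∈ Finset.univ, 0 ≤ w i * ew x γ i y := fun i _ =>
    mul_nonneg (hw i) (ew_pos _ _ _ _).le
  refine lt_of_le_of_ne (Finset.sum_nonneg h0) fun h => ?_
  have h2 := (Finset.sum_eq_zero_iff_of_nonneg h0).1 h.symm
  have : ∑ i, w i = 0 := Finset.sum_eq_zero fun i hi => by
    have := h2 i hi
    exact (mul_eq_zero.1 this).resolve_right (ew_pos _ _ _ _).ne'
  linarith

lemma br_abs_le {w : ι → ℝ} (x : ι → κ → ℝ) (γ : ℝ) (hw : ∀ i, 0 ≤ w i) (hw1 : ∑ i, w i = 1)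
    (f : ι → ℝ) (y : κ → ℝ) : |br w x γ f y| ≤ ∑ i, |f i| := by
  unfold br
  rw [abs_div, abs_of_pos (zf_pos x γ hw hw1 y), div_le_iff₀ (zf_pos x γ hw hw1 y)]
  refine (Finset.abs_sum_le_sum_abs _ _).trans ?_
  unfold zf
  rw [Finset.mul_sum]
  refine Finset.sum_le_sum fun i _ => ?_
  rw [abs_mul, abs_mul, abs_of_nonneg (hw i), abs_of_pos (ew_pos _ _ _ _)]
  have h1 : |f i| ≤ ∑ j, |f j| :=
    Finset.single_le_sum (f := fun j => |f j|) (fun j _ => abs_nonneg _) (Finset.mem_univ i)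
  have h2 : 0 ≤ w i * ew x γ i y := mul_nonneg (hw i) (ew_pos _ _ _ _).le
  nlinarith

lemma br_add (w : ι → ℝ) (x : ι → κ → ℝ) (γ : ℝ) (f f' : ι → ℝ) (y : κ → ℝ) :
    br w x γ (fun i => f i + f' i) y = br w x γ f y + br w x γ f' y := by
  unfold br
  rw [← add_div, ← Finset.sum_add_distrib]
  congr 1
  exact Finset.sum_congr rfl fun i _ => by ring

lemma br_smul (w : ι → ℝ) (x : ι → κ → ℝ) (γ : ℝ) (c : ℝ) (f : ι → ℝ) (y : κ → ℝ) :
    br w x γ (fun i => c * f i) y = c * br w x γ f y := by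
  unfold br
  rw [← mul_div_assoc, Finset.mul_sum]
  congr 1
  exact Finset.sum_congr rfl fun i _ => by ring

lemma br_sum {α : Type*} (s : Finset α) (w : ι → ℝ) (x : ι → κ → ℝ) (γ : ℝ) (f : α → ι → ℝ)
    (y : κ → ℝ) :
    br w x γ (fun i => ∑ k ∈ s, f k i) y = ∑ k ∈ s, br w x γ (f k) y := by
  unfold br
  rw [← Finset.sum_div, Finset.sum_comm]
  congr 1
  exact Finset.sum_congr rfl fun i _ => by rw [Finset.sum_mul, Finset.mul_sum]

/-- Continuous functions of at most linear growth. -/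
def LinG (φ : (κ → ℝ) → ℝ) : Prop := Continuous φ ∧ ∃ C, ∀ y, |φ y| ≤ C * (1 + ‖y‖)

lemma LinG.integrable {φ : (κ → ℝ) → ℝ} (h : LinG φ) (x : ι → κ → ℝ) (γ : ℝ) (i : ι) :
    Integrable (fun g => φ (Wf x γ i g)) (gpi κ) := by
  obtain ⟨hc, C, hC⟩ := h
  have hC0 : 0 ≤ C := by
    have := (abs_nonneg _).trans (hC 0)
    simpa using this
  refine Integrable.mono' (g := fun g => C * (1 + (‖γ • x i‖ + ‖√γ‖ * ‖g‖)))
    ?_ (hc.comp (Wf_continuous x γ i)).aestronglyMeasurable (Eventually.of_forall fun g => ?_)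
  · exact ((integrable_const _).add ((integrable_const _).add
      (gpi_integrable_norm.const_mul _))).const_mul _
  · refine (hC _).trans ?_
    gcongr
    unfold Wf
    exact (norm_add_le _ _).trans (by rw [norm_smul (√γ)])

lemma LinG.const (c : ℝ) : LinG (fun _ : κ → ℝ => c) :=
  ⟨continuous_const, |c|, fun y => by
    have := norm_nonneg y
    have := abs_nonneg c
    nlinarith⟩

lemma LinG.dot (a : κ → ℝ) : LinG (fun y : κ → ℝ => a ⬝ᵥ y) := by
  refine ⟨dot_continuous a, ∑ k, |a k|, fun y => ?_⟩
  simp only [dotProduct]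
  refine (Finset.abs_sum_le_sum_abs _ _).trans ?_
  rw [Finset.sum_mul]
  refine Finset.sum_le_sum fun k _ => ?_
  rw [abs_mul]
  have : |y k| ≤ ‖y‖ := norm_le_pi_norm y k
  gcongr
  linarith

lemma LinG.br {w : ι → ℝ} (x : ι → κ → ℝ) (γ : ℝ) (hw : ∀ i, 0 ≤ w i) (hw1 : ∑ i, w i = 1)
    {f : ι → (κ → ℝ) → ℝ} (hf : ∀ i, LinG (f i)) :
    LinG (fun y => br w x γ (fun i => f i y) y) := by
  choose hc C hC using hf
  refine ⟨?_, ∑ i, C i, fun y => ?_⟩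
  · unfold _root_.br
    refine Continuous.div ?_ (zf_continuous w x γ) fun y => (zf_pos x γ hw hw1 y).ne'
    have := ew_continuous x γ
    fun_prop
  · refine (br_abs_le x γ hw hw1 _ _).trans ?_
    rw [Finset.sum_mul]
    exact Finset.sum_le_sum fun i _ => hC i y

lemma Wf_eq (x : ι → κ → ℝ) {γ : ℝ} (hγ : 0 ≤ γ) (i : ι) (g : κ → ℝ) :
    Wf x γ i g = √γ • (g + √γ • x i) := by
  unfold Wf
  rw [smul_add, smul_smul, Real.mul_self_sqrt hγ, add_comm]

lemma ew_sqrt (x : ι → κ → ℝ) {γ : ℝ} (hγ : 0 ≤ γ) (i : ι) (g : κ → ℝ) :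
    ew x γ i (√γ • g) = exp ((√γ • x i) ⬝ᵥ g - (√γ • x i) ⬝ᵥ (√γ • x i) / 2) := by
  unfold ew
  simp only [dotProduct_smul, smul_dotProduct, smul_eq_mul]
  rw [← mul_assoc (√γ) (√γ), Real.mul_self_sqrt hγ]

lemma Wf_cm (x : ι → κ → ℝ) {γ : ℝ} (hγ : 0 ≤ γ) (i : ι) (φ : (κ → ℝ) → ℝ) :
    ∫ g, φ (Wf x γ i g) ∂(gpi κ) = ∫ g, φ (√γ • g) * ew x γ i (√γ • g) ∂(gpi κ) := by
  simp_rw [Wf_eq x hγ, ew_sqrt x hγ]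
  exact gpi_cm (√γ • x i) (fun g => φ (√γ • g))

lemma Wf_cm_integrable (x : ι → κ → ℝ) {γ : ℝ} (hγ : 0 ≤ γ) (i : ι) (φ : (κ → ℝ) → ℝ) :
    Integrable (fun g => φ (Wf x γ i g)) (gpi κ) ↔
      Integrable (fun g => φ (√γ • g) * ew x γ i (√γ • g)) (gpi κ) := by
  simp_rw [Wf_eq x hγ, ew_sqrt x hγ]
  exact gpi_cm_integrable (√γ • x i) (fun g => φ (√γ • g))

/-- Nishimori identity. -/
lemma nishimori {w : ι → ℝ} (x : ι → κ → ℝ) {γ : ℝ} (hγ : 0 ≤ γ)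
    (hw : ∀ i, 0 ≤ w i) (hw1 : ∑ i, w i = 1)
    {f : ι → (κ → ℝ) → ℝ} (hf : ∀ i, LinG (f i)) :
    ∑ j, w j * ∫ g, br w x γ (fun i => f i (Wf x γ j g)) (Wf x γ j g) ∂(gpi κ)
      = ∑ i, w i * ∫ g, f i (Wf x γ i g) ∂(gpi κ) := by
  have hb := LinG.br x γ hw hw1 hf
  have e1 : ∀ j, ∫ g, br w x γ (fun i => f i (Wf x γ j g)) (Wf x γ j g) ∂(gpi κ)
      = ∫ g, br w x γ (fun i => f i (√γ • g)) (√γ • g) * ew x γ j (√γ • g) ∂(gpi κ) :=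
    fun j => Wf_cm x hγ j (fun y => br w x γ (fun i => f i y) y)
  simp_rw [e1, Wf_cm x hγ _ (f _), ← integral_const_mul]
  rw [← integral_finsetSum, ← integral_finsetSum]
  · refine integral_congr_ae (Eventually.of_forall fun g => ?_)
    simp only
    have : ∀ j, w j * (br w x γ (fun i => f i (√γ • g)) (√γ • g) * ew x γ j (√γ • g))
      = br w x γ (fun i => f i (√γ • g)) (√γ • g) * (w j * ew x γ j (√γ • g)) := fun j => by ring
    simp_rw [this]
    rw [← Finset.mul_sum]
    change _ * zf w x γ (√γ • g) = _
    unfold br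
    rw [div_mul_cancel₀ _ (zf_pos x γ hw hw1 _).ne']
  · intro i _
    exact ((Wf_cm_integrable x hγ i (f i)).1 ((hf i).integrable x γ i)).const_mul _
  · intro j _
    exact ((Wf_cm_integrable x hγ j (fun y => br w x γ (fun i => f i y) y)).1
      (hb.integrable x γ j)).const_mul _

/-- Free energy of the channel. -/
def chF (w : ι → ℝ) (x : ι → κ → ℝ) (γ : ℝ) : ℝ :=
  ∑ i, w i * ∫ g, log (zf w x γ (Wf x γ i g)) ∂(gpi κ)

/-- Overlap of the channel. -/
def chQ (w : ι → ℝ) (x : ι → κ → ℝ) (γ : ℝ) : ℝ :=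
  ∑ i, w i * ∫ g, br w x γ (fun j => x j ⬝ᵥ x i) (Wf x γ i g) ∂(gpi κ)

lemma LinG.logz {w : ι → ℝ} (x : ι → κ → ℝ) (γ : ℝ) (hw : ∀ i, 0 ≤ w i) (hw1 : ∑ i, w i = 1) :
    LinG (fun y => log (zf w x γ y)) := by
  choose hc C hC using fun i => LinG.dot (x i)
  refine ⟨(zf_continuous w x γ).log fun y => (zf_pos x γ hw hw1 y).ne',
    ∑ i, (C i + |γ * (x i ⬝ᵥ x i) / 2|), fun y => ?_⟩
  have hM : ∀ i, |x i ⬝ᵥ y - γ * (x i ⬝ᵥ x i) / 2| ≤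
      (∑ i, (C i + |γ * (x i ⬝ᵥ x i) / 2|)) * (1 + ‖y‖) := by
    intro i
    have h1 : |x i ⬝ᵥ y - γ * (x i ⬝ᵥ x i) / 2| ≤ (C i + |γ * (x i ⬝ᵥ x i) / 2|) * (1 + ‖y‖) := by
      refine (abs_sub _ _).trans ?_
      have := hC i y
      have := norm_nonneg y
      have := abs_nonneg (γ * (x i ⬝ᵥ x i) / 2)
      nlinarith
    refine h1.trans ?_
    rw [Finset.sum_mul]
    refine Finset.single_le_sum (f := fun i => (C i + |γ * (x i ⬝ᵥ x i) / 2|) * (1 + ‖y‖))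
      (fun j _ => ?_) (Finset.mem_univ i)
    have h3 := (abs_nonneg _).trans (hC j y)
    have := norm_nonneg y
    have := abs_nonneg (γ * (x j ⬝ᵥ x j) / 2)
    nlinarith
  generalize (∑ i, (C i + |γ * (x i ⬝ᵥ x i) / 2|)) * (1 + ‖y‖) = M at *
  have hz := zf_pos x γ hw hw1 y
  rw [abs_le]
  constructor
  · rw [Real.le_log_iff_exp_le hz]
    calc exp (-M) = ∑ i, w i * exp (-M) := by rw [← Finset.sum_mul, hw1, one_mul]
      _ ≤ zf w x γ y := Finset.sum_le_sum fun i _ =>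
        mul_le_mul_of_nonneg_left (exp_le_exp.2 (abs_le.1 (hM i)).1) (hw i)
  · rw [Real.log_le_iff_le_exp hz]
    calc zf w x γ y ≤ ∑ i, w i * exp M := Finset.sum_le_sum fun i _ =>
        mul_le_mul_of_nonneg_left (exp_le_exp.2 (abs_le.1 (hM i)).2) (hw i)
      _ = exp M := by rw [← Finset.sum_mul, hw1, one_mul]

lemma hasDerivAt_logz {w : ι → ℝ} (x : ι → κ → ℝ) {γ : ℝ} (hγ : 0 < γ)
    (hw : ∀ i, 0 ≤ w i) (hw1 : ∑ i, w i = 1) (i : ι) (g : κ → ℝ) :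
    HasDerivAt (fun γ => log (zf w x γ (Wf x γ i g)))
      (br w x γ (fun j => x j ⬝ᵥ x i + 1 / (2 * √γ) * (x j ⬝ᵥ g) - (x j ⬝ᵥ x j) / 2)
        (Wf x γ i g)) γ := by
  have h1 : ∀ j, HasDerivAt (fun γ => ew x γ j (Wf x γ i g))
      ((x j ⬝ᵥ x i + 1 / (2 * √γ) * (x j ⬝ᵥ g) - (x j ⬝ᵥ x j) / 2) * ew x γ j (Wf x γ i g)) γ := by
    intro j
    have e : ∀ γ, ew x γ j (Wf x γ i g)
        = exp (γ * (x j ⬝ᵥ x i) + √γ * (x j ⬝ᵥ g) - γ * ((x j ⬝ᵥ x j) / 2)) := by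
      intro γ
      unfold ew Wf
      rw [dotProduct_add, dotProduct_smul, dotProduct_smul]
      simp only [smul_eq_mul]
      congr 1
      ring
    simp_rw [e]
    have := ((((hasDerivAt_id γ).mul_const (x j ⬝ᵥ x i)).add
      ((Real.hasDerivAt_sqrt hγ.ne').mul_const (x j ⬝ᵥ g))).sub
      ((hasDerivAt_id γ).mul_const ((x j ⬝ᵥ x j) / 2))).exp
    refine this.congr_deriv ?_
    simp only [Pi.add_apply, Pi.sub_apply, id]
    ring
  have h2 : HasDerivAt (fun γ => zf w x γ (Wf x γ i g)) _ γ :=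
    HasDerivAt.fun_sum (u := Finset.univ) fun j _ => (h1 j).const_mul (w j)
  exact h2.log (zf_pos x γ hw hw1 _).ne'

lemma hasDerivAt_intlogz {w : ι → ℝ} (x : ι → κ → ℝ) {γ : ℝ} (hγ : 0 < γ)
    (hw : ∀ i, 0 ≤ w i) (hw1 : ∑ i, w i = 1) (i : ι) :
    HasDerivAt (fun γ => ∫ g, log (zf w x γ (Wf x γ i g)) ∂(gpi κ))
      (∫ g, br w x γ (fun j => x j ⬝ᵥ x i + 1 / (2 * √γ) * (x j ⬝ᵥ g) - (x j ⬝ᵥ x j) / 2)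
        (Wf x γ i g) ∂(gpi κ)) γ := by
  refine (hasDerivAt_integral_of_dominated_loc_of_deriv_le (s := Set.Ioi (γ / 2)) (μ := gpi κ)
    (F := fun γ g => log (zf w x γ (Wf x γ i g))) (x₀ := γ)
    (F' := fun γ g => br w x γ
      (fun j => x j ⬝ᵥ x i + 1 / (2 * √γ) * (x j ⬝ᵥ g) - (x j ⬝ᵥ x j) / 2) (Wf x γ i g))
    (bound := fun g => ∑ j, (|x j ⬝ᵥ x i| + 1 / (2 * √(γ / 2)) * |x j ⬝ᵥ g| + |(x j ⬝ᵥ x j) / 2|))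
    (Ioi_mem_nhds (half_lt_self hγ)) ?_ ?_ ?_ ?_ ?_ ?_).2
  · exact Eventually.of_forall fun γ' =>
      ((LinG.logz x γ' hw hw1).integrable x γ' i).aestronglyMeasurable
  · exact (LinG.logz x γ hw hw1).integrable x γ i
  · refine Continuous.aestronglyMeasurable ?_
    unfold br
    refine Continuous.div ?_ ((zf_continuous w x γ).comp (Wf_continuous x γ i))
      fun y => (zf_pos x γ hw hw1 _).ne'
    have h1 := fun j => (ew_continuous x γ j).comp (Wf_continuous x γ i)
    have h2 := fun j => dot_continuous (x j)
    simp only [Function.comp_def] at h1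
    fun_prop
  · refine Eventually.of_forall fun g γ' hγ' => ?_
    refine (br_abs_le x γ' hw hw1 _ _).trans (Finset.sum_le_sum fun j _ => ?_)
    refine (abs_sub _ _).trans (add_le_add_left ((abs_add_le _ _).trans (add_le_add_right ?_ _)) _)
    have hp : 0 < √(γ / 2) := Real.sqrt_pos.2 (by linarith)
    have hl : √(γ / 2) ≤ √γ' := Real.sqrt_le_sqrt (le_of_lt hγ')
    rw [abs_mul, abs_of_nonneg (by positivity : (0:ℝ) ≤ 1 / (2 * √γ'))]
    gcongr
  · exact integrable_finsetSum _ fun j _ => ((integrable_const _).add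
      ((gpi_integrable_dot (x j)).abs.const_mul _)).add (integrable_const _)
  · refine Eventually.of_forall fun g γ' hγ' => ?_
    exact hasDerivAt_logz x (lt_trans (by linarith : 0 < γ / 2) hγ') hw hw1 i g

lemma chF_hasDerivAt {w : ι → ℝ} (x : ι → κ → ℝ) {γ : ℝ} (hγ : 0 < γ)
    (hw : ∀ i, 0 ≤ w i) (hw1 : ∑ i, w i = 1) :
    HasDerivAt (chF w x) (1 / 2 * chQ w x γ) γ := by
  have h : HasDerivAt (chF w x) _ γ := HasDerivAt.fun_sum (u := Finset.univ) fun i _ =>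
    (hasDerivAt_intlogz x hγ hw hw1 i).const_mul (w i)
  refine h.congr_deriv ?_
  have e1 : ∀ i g, br w x γ
      (fun j => x j ⬝ᵥ x i + 1 / (2 * √γ) * (x j ⬝ᵥ g) - (x j ⬝ᵥ x j) / 2) (Wf x γ i g)
      = 1 / 2 * br w x γ (fun j => x j ⬝ᵥ x i) (Wf x γ i g)
        + br w x γ (fun j => 1 / (2 * γ) * (x j ⬝ᵥ Wf x γ i g) + (-1 / 2) * (x j ⬝ᵥ x j))
          (Wf x γ i g) := by
    intro i g
    rw [← br_smul, ← br_add]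
    congr 1
    ext j
    unfold Wf
    rw [dotProduct_add, dotProduct_smul, dotProduct_smul]
    simp only [smul_eq_mul]
    have hs : √γ ≠ 0 := (Real.sqrt_pos.2 hγ).ne'
    have : γ = √γ * √γ := (Real.mul_self_sqrt hγ.le).symm
    have e3 : 1 / (2 * √γ) = 1 / (2 * γ) * √γ := by
      rw [div_mul_eq_mul_div, div_eq_div_iff (by positivity) (by positivity)]
      nlinarith
    rw [e3]
    field_simp
    ring
  have hl : ∀ j, LinG (fun y => 1 / (2 * γ) * (x j ⬝ᵥ y) + (-1 / 2) * (x j ⬝ᵥ x j)) := by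
    intro j
    have h1 := LinG.dot ((1 / (2 * γ)) • x j)
    obtain ⟨hc, C, hC⟩ := h1
    refine ⟨by have := dot_continuous (x j); fun_prop, C + |(-1 / 2) * (x j ⬝ᵥ x j)|, fun y => ?_⟩
    have h2 := hC y
    simp only [smul_dotProduct, smul_eq_mul] at h2
    refine (abs_add_le _ _).trans ?_
    have := norm_nonneg y
    have := abs_nonneg ((-1 / 2) * (x j ⬝ᵥ x j))
    nlinarith
  have hn := nishimori x hγ.le hw hw1 hl
  have hi1 : ∀ i, Integrable (fun g => br w x γ (fun j => x j ⬝ᵥ x i) (Wf x γ i g)) (gpi κ) :=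
    fun i => (LinG.br x γ hw hw1 (f := fun j _ => x j ⬝ᵥ x i)
      (fun j => LinG.const _)).integrable x γ i
  have hi2 : ∀ i, Integrable (fun g => br w x γ (fun j => 1 / (2 * γ) * (x j ⬝ᵥ Wf x γ i g)
      + (-1 / 2) * (x j ⬝ᵥ x j)) (Wf x γ i g)) (gpi κ) :=
    fun i => (LinG.br x γ hw hw1 hl).integrable x γ i
  simp_rw [e1]
  have e2 : ∀ i, ∫ g, (1 / 2 * br w x γ (fun j => x j ⬝ᵥ x i) (Wf x γ i g)
        + br w x γ (fun j => 1 / (2 * γ) * (x j ⬝ᵥ Wf x γ i g) + (-1 / 2) * (x j ⬝ᵥ x j))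
          (Wf x γ i g)) ∂(gpi κ)
      = 1 / 2 * ∫ g, br w x γ (fun j => x j ⬝ᵥ x i) (Wf x γ i g) ∂(gpi κ)
        + ∫ g, br w x γ (fun j => 1 / (2 * γ) * (x j ⬝ᵥ Wf x γ i g) + (-1 / 2) * (x j ⬝ᵥ x j))
          (Wf x γ i g) ∂(gpi κ) := fun i => by
    rw [integral_add ((hi1 i).const_mul _) (hi2 i), integral_const_mul]
  simp_rw [e2, mul_add, Finset.sum_add_distrib]
  rw [hn]
  have e4 : ∀ i, ∫ g, (1 / (2 * γ) * (x i ⬝ᵥ Wf x γ i g) + (-1 / 2) * (x i ⬝ᵥ x i)) ∂(gpi κ) = 0 := by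
    intro i
    have : ∀ g, (1 / (2 * γ) * (x i ⬝ᵥ Wf x γ i g) + (-1 / 2) * (x i ⬝ᵥ x i))
      = (1 / (2 * γ) * √γ) * (x i ⬝ᵥ g) := by
      intro g
      unfold Wf
      rw [dotProduct_add, dotProduct_smul, dotProduct_smul]
      simp only [smul_eq_mul]
      field_simp
      ring
    simp_rw [this]
    rw [integral_const_mul, gpi_integral_dot, mul_zero]
  simp_rw [e4]
  unfold chQ
  rw [Finset.mul_sum]
  simp only [mul_zero, Finset.sum_const_zero, add_zero]
  exact Finset.sum_congr rfl fun i _ => by ring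

/-- Unnormalised first moment. -/
def nf (w : ι → ℝ) (x : ι → κ → ℝ) (γ : ℝ) (k : κ) (y : κ → ℝ) : ℝ :=
  ∑ i, w i * (x i k * ew x γ i y)

lemma nish_sq {w : ι → ℝ} (x : ι → κ → ℝ) {γ : ℝ} (hγ : 0 ≤ γ)
    (hw : ∀ i, 0 ≤ w i) (hw1 : ∑ i, w i = 1) (k : κ) :
    ∑ j, w j * ∫ g, (br w x γ (fun i => x i k) (Wf x γ j g)) ^ 2 ∂(gpi κ)
      = ∑ j, w j * ∫ g, x j k * br w x γ (fun i => x i k) (Wf x γ j g) ∂(gpi κ) := by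
  have hb : LinG (fun y => br w x γ (fun i => x i k) y) :=
    LinG.br x γ hw hw1 (f := fun i _ => x i k) fun i => LinG.const _
  have hl : ∀ i, LinG (fun y => x i k * br w x γ (fun i => x i k) y) := by
    intro i
    obtain ⟨hc, C, hC⟩ := hb
    refine ⟨continuous_const.mul hc, |x i k| * C, fun y => ?_⟩
    rw [abs_mul, mul_assoc]
    exact mul_le_mul_of_nonneg_left (hC y) (abs_nonneg _)
  have h := nishimori x hγ hw hw1 hl
  rw [← h]
  refine Finset.sum_congr rfl fun j _ => ?_
  congr 1
  refine integral_congr_ae (Eventually.of_forall fun g => ?_)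
  simp only
  rw [sq, ← br_smul]
  congr 1
  ext i
  ring

lemma br_integrable {w : ι → ℝ} (x : ι → κ → ℝ) (γ : ℝ)
    (hw : ∀ i, 0 ≤ w i) (hw1 : ∑ i, w i = 1) (f : ι → ℝ) (j : ι) :
    Integrable (fun g => br w x γ f (Wf x γ j g)) (gpi κ) :=
  (LinG.br x γ hw hw1 (f := fun i _ => f i) fun i => LinG.const _).integrable x γ j

lemma br_sq_integrable {w : ι → ℝ} (x : ι → κ → ℝ) (γ : ℝ)
    (hw : ∀ i, 0 ≤ w i) (hw1 : ∑ i, w i = 1) (f : ι → ℝ) (j : ι) :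
    Integrable (fun g => (br w x γ f (Wf x γ j g)) ^ 2) (gpi κ) := by
  have hb : LinG (fun y => br w x γ f y) :=
    LinG.br x γ hw hw1 (f := fun i _ => f i) fun i => LinG.const _
  have : LinG (fun y => (br w x γ f y) ^ 2) := by
    refine ⟨hb.1.pow 2, (∑ i, |f i|) ^ 2, fun y => ?_⟩
    rw [abs_of_nonneg (sq_nonneg _)]
    have h1 := sq_le_sq.2 ((br_abs_le x γ hw hw1 f y).trans (le_abs_self _))
    have := norm_nonneg y
    nlinarith [sq_nonneg (∑ i, |f i|)]
  exact this.integrable x γ j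

lemma chQ_eq {w : ι → ℝ} (x : ι → κ → ℝ) {γ : ℝ} 
    (hw : ∀ i, 0 ≤ w i) (hw1 : ∑ i, w i = 1) :
    chQ w x γ = ∑ k, ∑ j, w j * ∫ g, x j k * br w x γ (fun i => x i k) (Wf x γ j g) ∂(gpi κ) := by
  unfold chQ
  rw [Finset.sum_comm]
  refine Finset.sum_congr rfl fun j _ => ?_
  rw [← Finset.mul_sum, ← integral_finsetSum]
  · congr 1
    refine integral_congr_ae (Eventually.of_forall fun g => ?_)
    simp only
    simp_rw [← br_smul, ← br_sum]
    congr 1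
    ext i
    simp only [dotProduct]
    exact Finset.sum_congr rfl fun k _ => mul_comm _ _
  · intro k _
    exact (br_integrable x γ hw hw1 _ j).const_mul _

/-- MMSE relation for the channel. -/
lemma ch_mmse {w : ι → ℝ} (x : ι → κ → ℝ) {γ : ℝ} (hγ : 0 ≤ γ)
    (hw : ∀ i, 0 ≤ w i) (hw1 : ∑ i, w i = 1) :
    ∑ k, ∑ j, w j * ∫ g, (x j k - br w x γ (fun i => x i k) (Wf x γ j g)) ^ 2 ∂(gpi κ)
      = ∑ k, ∑ j, w j * x j k ^ 2 - chQ w x γ := by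
  rw [chQ_eq x hw hw1, ← Finset.sum_sub_distrib]
  refine Finset.sum_congr rfl fun k _ => ?_
  have e : ∀ j, ∫ g, (x j k - br w x γ (fun i => x i k) (Wf x γ j g)) ^ 2 ∂(gpi κ)
      = x j k ^ 2 - 2 * (∫ g, x j k * br w x γ (fun i => x i k) (Wf x γ j g) ∂(gpi κ))
        + ∫ g, (br w x γ (fun i => x i k) (Wf x γ j g)) ^ 2 ∂(gpi κ) := by
    intro j
    have h1 := br_integrable x γ hw hw1 (fun i => x i k) j
    have h2 := br_sq_integrable x γ hw hw1 (fun i => x i k) j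
    simp_rw [sub_sq]
    rw [integral_add _ h2, integral_sub (integrable_const _)]
    · simp only [mul_assoc, integral_const_mul]
      simp
    · exact h1.const_mul _
    · exact (integrable_const _).sub (h1.const_mul _)
  simp_rw [e, mul_add, mul_sub, Finset.sum_add_distrib, Finset.sum_sub_distrib]
  rw [nish_sq x hγ hw hw1 k]
  have : ∀ j, w j * (2 * ∫ g, x j k * br w x γ (fun i => x i k) (Wf x γ j g) ∂(gpi κ))
    = 2 * (w j * ∫ g, x j k * br w x γ (fun i => x i k) (Wf x γ j g) ∂(gpi κ)) := fun j => by ring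
  simp_rw [this, ← Finset.mul_sum]
  ring

lemma ew_step (x : ι → κ → ℝ) (γ : ℝ) {δ : ℝ} (hδ : 0 ≤ δ) (i : ι) (y h : κ → ℝ) :
    ew x (γ + δ) i (y + √δ • h)
      = ew x γ i y * exp ((√δ • x i) ⬝ᵥ h - (√δ • x i) ⬝ᵥ (√δ • x i) / 2) := by
  rw [← ew_sqrt x hδ]
  unfold ew
  rw [← Real.exp_add, dotProduct_add]
  congr 1
  ring

lemma ew_step_integrable (x : ι → κ → ℝ) (γ : ℝ) {δ : ℝ} (hδ : 0 ≤ δ) (i : ι) (y : κ → ℝ) :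
    Integrable (fun h => ew x (γ + δ) i (y + √δ • h)) (gpi κ) := by
  simp_rw [ew_step x γ hδ]
  exact (gpi_exp_integrable _).const_mul _

lemma ew_step_integral (x : ι → κ → ℝ) (γ : ℝ) {δ : ℝ} (hδ : 0 ≤ δ) (i : ι) (y : κ → ℝ) :
    ∫ h, ew x (γ + δ) i (y + √δ • h) ∂(gpi κ) = ew x γ i y := by
  simp_rw [ew_step x γ hδ]
  rw [integral_const_mul, gpi_exp_integral, mul_one]

lemma comb_step_integrable (x : ι → κ → ℝ) (γ : ℝ) {δ : ℝ} (hδ : 0 ≤ δ) (c : ι → ℝ) (y : κ → ℝ) :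
    Integrable (fun h => ∑ i, c i * ew x (γ + δ) i (y + √δ • h)) (gpi κ) :=
  integrable_finsetSum _ fun i _ => (ew_step_integrable x γ hδ i y).const_mul _

lemma comb_step_integral (x : ι → κ → ℝ) (γ : ℝ) {δ : ℝ} (hδ : 0 ≤ δ) (c : ι → ℝ) (y : κ → ℝ) :
    ∫ h, ∑ i, c i * ew x (γ + δ) i (y + √δ • h) ∂(gpi κ) = ∑ i, c i * ew x γ i y := by
  rw [integral_finsetSum _ fun i _ => (ew_step_integrable x γ hδ i y).const_mul _]
  exact Finset.sum_congr rfl fun i _ => by rw [integral_const_mul, ew_step_integral x γ hδ]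

/-- `⟨x_k⟩² · Z`. -/
def qf (w : ι → ℝ) (x : ι → κ → ℝ) (γ : ℝ) (k : κ) (y : κ → ℝ) : ℝ :=
  (br w x γ (fun i => x i k) y) ^ 2 * zf w x γ y

lemma qf_tangent {w : ι → ℝ} (x : ι → κ → ℝ) (γ : ℝ)
    (hw : ∀ i, 0 ≤ w i) (hw1 : ∑ i, w i = 1) (k : κ) (y : κ → ℝ) (t : ℝ) :
    ∑ i, (w i * (2 * t * x i k - t ^ 2)) * ew x γ i y ≤ qf w x γ k y := by
  have e : ∑ i, (w i * (2 * t * x i k - t ^ 2)) * ew x γ i y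
      = (2 * t * br w x γ (fun i => x i k) y - t ^ 2) * zf w x γ y := by
    unfold br
    rw [sub_mul, mul_assoc, div_mul_cancel₀ _ (zf_pos x γ hw hw1 y).ne']
    unfold zf
    rw [Finset.mul_sum, Finset.mul_sum, ← Finset.sum_sub_distrib]
    exact Finset.sum_congr rfl fun i _ => by ring
  rw [e]
  unfold qf
  refine mul_le_mul_of_nonneg_right ?_ (zf_pos x γ hw hw1 y).le
  nlinarith [sq_nonneg (br w x γ (fun i => x i k) y - t)]

lemma qf_eq {w : ι → ℝ} (x : ι → κ → ℝ) (γ : ℝ)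
    (hw : ∀ i, 0 ≤ w i) (hw1 : ∑ i, w i = 1) (k : κ) (y : κ → ℝ) :
    ∑ i, (w i * (2 * (br w x γ (fun i => x i k) y) * x i k - (br w x γ (fun i => x i k) y) ^ 2))
      * ew x γ i y = qf w x γ k y := by
  set t := br w x γ (fun i => x i k) y with ht
  have e : ∑ i, (w i * (2 * t * x i k - t ^ 2)) * ew x γ i y
      = (2 * t * br w x γ (fun i => x i k) y - t ^ 2) * zf w x γ y := by
    unfold br
    rw [sub_mul, mul_assoc, div_mul_cancel₀ _ (zf_pos x γ hw hw1 y).ne']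
    unfold zf
    rw [Finset.mul_sum, Finset.mul_sum, ← Finset.sum_sub_distrib]
    exact Finset.sum_congr rfl fun i _ => by ring
  rw [e, ← ht]
  unfold qf
  rw [← ht]
  ring

lemma qf_continuous {w : ι → ℝ} (x : ι → κ → ℝ) (γ : ℝ)
    (hw : ∀ i, 0 ≤ w i) (hw1 : ∑ i, w i = 1) (k : κ) : Continuous (qf w x γ k) := by
  have hb : LinG (fun y => br w x γ (fun i => x i k) y) :=
    LinG.br x γ hw hw1 (f := fun i _ => x i k) fun i => LinG.const _
  exact (hb.1.pow 2).mul (zf_continuous w x γ)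

lemma qf_step {w : ι → ℝ} (x : ι → κ → ℝ) (γ : ℝ) {δ : ℝ} (hδ : 0 ≤ δ)
    (hw : ∀ i, 0 ≤ w i) (hw1 : ∑ i, w i = 1) (k : κ) (y : κ → ℝ) :
    qf w x γ k y ≤ ∫ h, qf w x (γ + δ) k (y + √δ • h) ∂(gpi κ) := by
  rw [← qf_eq x γ hw hw1, ← comb_step_integral x γ hδ]
  refine integral_mono (comb_step_integrable x γ hδ _ y) ?_
    fun h => qf_tangent x (γ + δ) hw hw1 k _ _
  refine Integrable.mono' ((comb_step_integrable x γ hδ w y).const_mul ((∑ i, |x i k|) ^ 2))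
    ((qf_continuous x (γ + δ) hw hw1 k).comp (by fun_prop)).aestronglyMeasurable
    (Eventually.of_forall fun h => ?_)
  have hz := (zf_pos x (γ + δ) hw hw1 (y + √δ • h)).le
  have hq : 0 ≤ qf w x (γ + δ) k (y + √δ • h) := mul_nonneg (sq_nonneg _) hz
  rw [Real.norm_of_nonneg hq]
  unfold qf
  refine mul_le_mul_of_nonneg_right ?_ hz
  exact sq_le_sq.2 ((br_abs_le x _ hw hw1 _ _).trans (le_abs_self _))

lemma qf_sqrt_eq {w : ι → ℝ} (x : ι → κ → ℝ) (γ : ℝ) (k : κ) (g : κ → ℝ) :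
    qf w x γ k (√γ • g) = ∑ j, w j *
      ((br w x γ (fun i => x i k) (√γ • g)) ^ 2 * ew x γ j (√γ • g)) := by
  unfold qf
  conv_lhs => rw [zf]
  rw [Finset.mul_sum]
  exact Finset.sum_congr rfl fun j _ => by ring

lemma qf_sqrt_integrable {w : ι → ℝ} (x : ι → κ → ℝ) {γ : ℝ} (hγ : 0 ≤ γ)
    (hw : ∀ i, 0 ≤ w i) (hw1 : ∑ i, w i = 1) (k : κ) :
    Integrable (fun g => qf w x γ k (√γ • g)) (gpi κ) := by
  simp_rw [qf_sqrt_eq]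
  exact integrable_finsetSum _ fun j _ => ((Wf_cm_integrable x hγ j
    (fun y => (br w x γ (fun i => x i k) y) ^ 2)).1 (br_sq_integrable x γ hw hw1 _ j)).const_mul _

lemma qf_sqrt_integral {w : ι → ℝ} (x : ι → κ → ℝ) {γ : ℝ} (hγ : 0 ≤ γ)
    (hw : ∀ i, 0 ≤ w i) (hw1 : ∑ i, w i = 1) (k : κ) :
    ∫ g, qf w x γ k (√γ • g) ∂(gpi κ)
      = ∑ j, w j * ∫ g, x j k * br w x γ (fun i => x i k) (Wf x γ j g) ∂(gpi κ) := by
  rw [← nish_sq x hγ hw hw1 k]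
  simp_rw [qf_sqrt_eq]
  rw [integral_finsetSum]
  · refine Finset.sum_congr rfl fun j _ => ?_
    rw [integral_const_mul, Wf_cm x hγ j (fun y => (br w x γ (fun i => x i k) y) ^ 2)]
  · exact fun j _ => ((Wf_cm_integrable x hγ j
      (fun y => (br w x γ (fun i => x i k) y) ^ 2)).1 (br_sq_integrable x γ hw hw1 _ j)).const_mul _

lemma qf_mono {w : ι → ℝ} (x : ι → κ → ℝ) {γ δ : ℝ} (hγ : 0 ≤ γ) (hδ : 0 ≤ δ)
    (hw : ∀ i, 0 ≤ w i) (hw1 : ∑ i, w i = 1) (k : κ) :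
    ∫ g, qf w x γ k (√γ • g) ∂(gpi κ) ≤ ∫ g, qf w x (γ + δ) k (√(γ + δ) • g) ∂(gpi κ) := by
  have hc := qf_continuous x (γ + δ) hw hw1 k
  have hintq := qf_sqrt_integrable x (add_nonneg hγ hδ) hw hw1 k
  have hm1 : AEMeasurable (fun g : κ → ℝ => √(γ + δ) • g) (gpi κ) := by fun_prop
  have hm2 : AEMeasurable (fun p : (κ → ℝ) × (κ → ℝ) => √γ • p.1 + √δ • p.2)
    ((gpi κ).prod (gpi κ)) := by fun_prop
  have hI : Integrable (fun p : (κ → ℝ) × (κ → ℝ) => qf w x (γ + δ) k (√γ • p.1 + √δ • p.2))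
      ((gpi κ).prod (gpi κ)) := by
    have h1 : Integrable (qf w x (γ + δ) k) ((gpi κ).map (fun g => √(γ + δ) • g)) :=
      (integrable_map_measure hc.aestronglyMeasurable hm1).2 hintq
    rw [← gpi_conv hγ hδ] at h1
    exact (integrable_map_measure hc.aestronglyMeasurable hm2).1 h1
  have e : ∫ g, qf w x (γ + δ) k (√(γ + δ) • g) ∂(gpi κ)
      = ∫ g, ∫ h, qf w x (γ + δ) k (√γ • g + √δ • h) ∂(gpi κ) ∂(gpi κ) := by
    rw [← integral_map hm1 hc.aestronglyMeasurable, ← gpi_conv hγ hδ,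
      integral_map hm2 hc.aestronglyMeasurable, integral_prod _ hI]
  rw [e]
  exact integral_mono (qf_sqrt_integrable x hγ hw hw1 k) hI.integral_prod_left
    fun g => qf_step x γ hδ hw hw1 k _

lemma chQ_mono {w : ι → ℝ} (x : ι → κ → ℝ) {γ γ' : ℝ} (hγ : 0 ≤ γ) (h : γ ≤ γ')
    (hw : ∀ i, 0 ≤ w i) (hw1 : ∑ i, w i = 1) : chQ w x γ ≤ chQ w x γ' := by
  rw [chQ_eq x hw hw1, chQ_eq x hw hw1]
  refine Finset.sum_le_sum fun k _ => ?_
  rw [← qf_sqrt_integral x hγ hw hw1 k, ← qf_sqrt_integral x (hγ.trans h) hw hw1 k]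
  have := qf_mono x hγ (sub_nonneg.2 h) hw hw1 k
  rwa [add_sub_cancel] at this

end channel

section reduction

lemma finsupp_integral {X : Type*} [MeasurableSpace X] [MeasurableSingletonClass X]
    (μ : Measure X) [IsFiniteMeasure μ] (T : Finset X) (hT : μ ((T : Set X)ᶜ) = 0) (f : X → ℝ) :
    ∫ a, f a ∂μ = ∑ t : {t // t ∈ T}, μ.real {t.1} * f t.1 := by
  have h : μ.restrict (T : Set X) = μ := Measure.restrict_eq_self_of_ae_mem hT
  have hI : IntegrableOn f (T : Set X) μ := IntegrableOn.finset
  have h2 := setIntegral_finset T hI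
  rw [h] at h2
  rw [h2, ← Finset.sum_coe_sort T]
  simp [smul_eq_mul]

lemma finsupp_prod {X Y : Type*} [MeasurableSpace X] [MeasurableSingletonClass X]
    [MeasurableSpace Y] (μ : Measure X) [IsFiniteMeasure μ] (ν : Measure Y) [IsFiniteMeasure ν]
    (T : Finset X) (hT : μ ((T : Set X)ᶜ) = 0) :
    μ.prod ν = ∑ t : {t // t ∈ T}, μ {t.1} • ν.map (Prod.mk t.1) := by
  have h : μ.restrict (T : Set X) = μ := Measure.restrict_eq_self_of_ae_mem hT
  refine Measure.ext_of_lintegral _ fun f hf => ?_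
  rw [lintegral_prod _ hf.aemeasurable, lintegral_finsetSum_measure]
  conv_lhs => rw [← h]
  rw [lintegral_finset, ← Finset.sum_coe_sort T]
  refine Finset.sum_congr rfl fun t _ => ?_
  rw [lintegral_smul_measure, lintegral_map hf (by fun_prop), smul_eq_mul, mul_comm]

lemma finsupp_prod_integral {X Y : Type*} [MeasurableSpace X] [MeasurableSingletonClass X]
    [MeasurableSpace Y] (μ : Measure X) [IsFiniteMeasure μ] (ν : Measure Y) [IsFiniteMeasure ν]
    (T : Finset X) (hT : μ ((T : Set X)ᶜ) = 0) (f : X × Y → ℝ)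
    (hf : ∀ t ∈ T, Integrable (fun y => f (t, y)) ν) :
    ∫ p, f p ∂(μ.prod ν) = ∑ t : {t // t ∈ T}, μ.real {t.1} * ∫ y, f (t.1, y) ∂ν := by
  rw [finsupp_prod μ ν T hT, integral_finsetSum_measure]
  · refine Finset.sum_congr rfl fun t _ => ?_
    rw [integral_smul_measure, (measurableEmbedding_prodMk_left t.1).integral_map]
    rfl
  · intro t _
    refine Integrable.smul_measure ?_ (measure_ne_top _ _)
    exact (measurableEmbedding_prodMk_left t.1).integrable_map_iff.2 (hf t.1 t.2)

variable (PU PV : Measure ℝ) [IsProbabilityMeasure PU] [IsProbabilityMeasure PV] (n : ℕ)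

instance prior_prob : IsProbabilityMeasure (prior PU PV n) := by unfold prior; infer_instance
instance noiseM_prob : IsProbabilityMeasure (noiseM n) := by unfold noiseM; infer_instance

/-- The finite support of the prior. -/
def supT (S : Finset ℝ) (n : ℕ) : Finset ((Fin n → ℝ) × (Fin n → ℝ)) :=
  (Fintype.piFinset fun _ => S) ×ˢ (Fintype.piFinset fun _ => S)

lemma prior_supT (S : Finset ℝ)
    (hUS : PU ((↑S : Set ℝ)ᶜ) = 0) (hVS : PV ((↑S : Set ℝ)ᶜ) = 0) :
    prior PU PV n ((supT S n : Set _)ᶜ) = 0 := by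
  have hU : ∀ᵐ u ∂(Measure.pi fun _ : Fin n => PU), ∀ i, u i ∈ S := by
    rw [ae_all_iff]
    intro i
    exact (Measure.tendsto_eval_ae_ae (μ := fun _ : Fin n => PU) (i := i)).eventually
      (p := fun t => t ∈ S) hUS
  have hV : ∀ᵐ u ∂(Measure.pi fun _ : Fin n => PV), ∀ i, u i ∈ S := by
    rw [ae_all_iff]
    intro i
    exact (Measure.tendsto_eval_ae_ae (μ := fun _ : Fin n => PV) (i := i)).eventually
      (p := fun t => t ∈ S) hVS
  have h1 : ∀ᵐ p ∂(prior PU PV n), p ∈ (supT S n : Set _) := by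
    unfold prior
    filter_upwards [Measure.quasiMeasurePreserving_fst.ae hU,
      Measure.quasiMeasurePreserving_snd.ae hV] with p h1 h2
    simp only [supT, Finset.mem_coe, Finset.mem_product, Fintype.mem_piFinset]
    exact ⟨h1, h2⟩
  exact h1

/-- weights -/
def wt (S : Finset ℝ) (t : {t // t ∈ supT S n}) : ℝ := (prior PU PV n).real {t.1}

/-- signals -/
def xt (S : Finset ℝ) (t : {t // t ∈ supT S n}) (k : Fin n × Fin n) : ℝ := t.1.1 k.1 * t.1.2 k.2

lemma wt_nonneg (S : Finset ℝ) (t) : 0 ≤ wt PU PV n S t := measureReal_nonneg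

lemma prior_integral (S : Finset ℝ)
    (hUS : PU ((↑S : Set ℝ)ᶜ) = 0) (hVS : PV ((↑S : Set ℝ)ᶜ) = 0)
    (f : (Fin n → ℝ) × (Fin n → ℝ) → ℝ) :
    ∫ a, f a ∂(prior PU PV n) = ∑ t, wt PU PV n S t * f t.1 :=
  finsupp_integral _ _ (prior_supT PU PV n S hUS hVS) f

lemma wt_sum (S : Finset ℝ)
    (hUS : PU ((↑S : Set ℝ)ᶜ) = 0) (hVS : PV ((↑S : Set ℝ)ᶜ) = 0) :
    ∑ t, wt PU PV n S t = 1 := by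
  have := prior_integral PU PV n S hUS hVS (fun _ => 1)
  simpa using this.symm

lemma sample_integral (S : Finset ℝ)
    (hUS : PU ((↑S : Set ℝ)ᶜ) = 0) (hVS : PV ((↑S : Set ℝ)ᶜ) = 0)
    (f : ((Fin n → ℝ) × (Fin n → ℝ)) × (Fin n → Fin n → ℝ) → ℝ)
    (F : {t // t ∈ supT S n} → (Fin n × Fin n → ℝ) → ℝ)
    (hfF : ∀ t g, f (t.1, Function.curry g) = F t g)
    (hF : ∀ t, Integrable (F t) (gpi (Fin n × Fin n))) :
    ∫ ω, f ω ∂(sampleM PU PV n) = ∑ t, wt PU PV n S t * ∫ g, F t g ∂(gpi (Fin n × Fin n)) := by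
  have e : noiseM n = (gpi (Fin n × Fin n)).map (MeasurableEquiv.curry (Fin n) (Fin n) ℝ) :=
    noise_eq n
  unfold sampleM
  rw [finsupp_prod_integral _ _ _ (prior_supT PU PV n S hUS hVS)]
  · refine Finset.sum_congr rfl fun t _ => ?_
    rw [e, (MeasurableEquiv.measurableEmbedding _).integral_map]
    simp_rw [← hfF]
    rfl
  · intro t ht
    rw [e, (MeasurableEquiv.measurableEmbedding _).integrable_map_iff]
    have := hF ⟨t, ht⟩
    refine this.congr (Eventually.of_forall fun g => ?_)
    exact (hfF ⟨t, ht⟩ g).symm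

lemma ham_eq (S : Finset ℝ) (lam : ℝ) (t s : {t // t ∈ supT S n}) (g : Fin n × Fin n → ℝ) :
    exp (Ham lam n t.1.1 t.1.2 (Function.curry g) s.1.1 s.1.2)
      = ew (xt n S) (lam / n) s (Wf (xt n S) (lam / n) t g) := by
  unfold Ham ew Wf
  congr 1
  simp only [dotProduct, Fintype.sum_prod_type, Finset.mul_sum, Finset.sum_div,
    ← Finset.sum_sub_distrib]
  refine Finset.sum_congr rfl fun i _ => Finset.sum_congr rfl fun j _ => ?_
  simp only [xt, Pi.add_apply, Pi.smul_apply, smul_eq_mul, Function.curry]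
  rw [show lam / (2 * (n : ℝ)) = lam / n / 2 by rw [div_div, mul_comm]]
  ring

variable (S : Finset ℝ) (hUS : PU ((↑S : Set ℝ)ᶜ) = 0) (hVS : PV ((↑S : Set ℝ)ᶜ) = 0)

lemma partFun_eq (hUS : PU ((↑S : Set ℝ)ᶜ) = 0) (hVS : PV ((↑S : Set ℝ)ᶜ) = 0)
    (lam : ℝ) (t : {t // t ∈ supT S n}) (g : Fin n × Fin n → ℝ) :
    partFun PU PV lam n (t.1, Function.curry g)
      = zf (wt PU PV n S) (xt n S) (lam / n) (Wf (xt n S) (lam / n) t g) := by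
  unfold partFun zf
  rw [prior_integral PU PV n S hUS hVS]
  exact Finset.sum_congr rfl fun s _ => by rw [ham_eq]

lemma gibbs_eq (hUS : PU ((↑S : Set ℝ)ᶜ) = 0) (hVS : PV ((↑S : Set ℝ)ᶜ) = 0)
    (lam : ℝ) (t : {t // t ∈ supT S n}) (g : Fin n × Fin n → ℝ)
    (f : (Fin n → ℝ) × (Fin n → ℝ) → ℝ) :
    gibbs PU PV lam n (t.1, Function.curry g) f
      = br (wt PU PV n S) (xt n S) (lam / n) (fun s => f s.1) (Wf (xt n S) (lam / n) t g) := by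
  unfold gibbs br
  rw [partFun_eq PU PV n S hUS hVS, prior_integral PU PV n S hUS hVS]
  congr 1
  exact Finset.sum_congr rfl fun s _ => by rw [ham_eq]

lemma freeEnergy_eq (hUS : PU ((↑S : Set ℝ)ᶜ) = 0) (hVS : PV ((↑S : Set ℝ)ᶜ) = 0) (lam : ℝ) :
    freeEnergy PU PV n lam = (1 / (n : ℝ)) * chF (wt PU PV n S) (xt n S) (lam / n) := by
  unfold freeEnergy chF
  congr 1
  refine sample_integral PU PV n S hUS hVS _ _ (fun t g => ?_) fun t =>
    (LinG.logz (xt n S) (lam / n) (wt_nonneg PU PV n S)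
      (wt_sum PU PV n S hUS hVS)).integrable _ _ t
  rw [partFun_eq PU PV n S hUS hVS]

lemma overlapExp_eq (hUS : PU ((↑S : Set ℝ)ᶜ) = 0) (hVS : PV ((↑S : Set ℝ)ᶜ) = 0) (lam : ℝ) :
    overlapExp PU PV n lam = (1 / (n : ℝ) ^ 2) * chQ (wt PU PV n S) (xt n S) (lam / n) := by
  unfold overlapExp chQ
  have hi := fun t => (br_integrable (xt n S) (lam / n) (wt_nonneg PU PV n S)
      (wt_sum PU PV n S hUS hVS) (fun j => xt n S j ⬝ᵥ xt n S t) t).const_mul (1 / (n : ℝ) ^ 2)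
  rw [sample_integral PU PV n S hUS hVS _ _ (fun t g => ?_) hi]
  · simp_rw [integral_const_mul]
    rw [Finset.mul_sum]
    exact Finset.sum_congr rfl fun t _ => by ring
  · rw [gibbs_eq PU PV n S hUS hVS, ← br_smul]
    congr 1
    ext s
    simp only [ovDot, dotProduct, Fintype.sum_prod_type, xt]
    rw [mul_mul_mul_comm, Finset.sum_mul_sum]
    congr 1
    · rw [← sq, div_pow, one_pow]
    · exact Finset.sum_congr rfl fun i _ => Finset.sum_congr rfl fun j _ => by ring

lemma MMSEn_eq (hUS : PU ((↑S : Set ℝ)ᶜ) = 0) (hVS : PV ((↑S : Set ℝ)ᶜ) = 0) {lam : ℝ}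
    (hlam : 0 < lam) :
    MMSEn PU PV n lam = (1 / (n : ℝ) ^ 2) *
      (∑ k, ∑ j, wt PU PV n S j * xt n S j k ^ 2
        - chQ (wt PU PV n S) (xt n S) (lam / n)) := by
  unfold MMSEn
  rw [← ch_mmse (xt n S) (by positivity : 0 ≤ lam / n) (wt_nonneg PU PV n S)
      (wt_sum PU PV n S hUS hVS), Fintype.sum_prod_type]
  congr 1
  refine Finset.sum_congr rfl fun i _ => Finset.sum_congr rfl fun j _ => ?_
  refine sample_integral PU PV n S hUS hVS _ _ (fun t g => ?_) fun t => ?_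
  · rw [gibbs_eq PU PV n S hUS hVS]
    rfl
  · have h1 := br_integrable (xt n S) (lam / n) (wt_nonneg PU PV n S)
      (wt_sum PU PV n S hUS hVS) (fun s => xt n S s (i, j)) t
    have h2 := br_sq_integrable (xt n S) (lam / n) (wt_nonneg PU PV n S)
      (wt_sum PU PV n S hUS hVS) (fun s => xt n S s (i, j)) t
    simp_rw [sub_sq]
    exact ((integrable_const _).sub (h1.const_mul _)).add h2

lemma second_moment (hUS : PU ((↑S : Set ℝ)ᶜ) = 0) (hVS : PV ((↑S : Set ℝ)ᶜ) = 0) :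
    ∑ k, ∑ j, wt PU PV n S j * xt n S j k ^ 2
      = (n : ℝ) ^ 2 * ((∫ x, x ^ 2 ∂PU) * (∫ x, x ^ 2 ∂PV)) := by
  have h : ∀ k : Fin n × Fin n, ∑ j, wt PU PV n S j * xt n S j k ^ 2
      = (∫ x, x ^ 2 ∂PU) * (∫ x, x ^ 2 ∂PV) := by
    intro k
    have h1 := prior_integral PU PV n S hUS hVS (fun p => p.1 k.1 ^ 2 * p.2 k.2 ^ 2)
    simp only [xt, mul_pow]
    rw [← h1]
    unfold prior
    rw [integral_prod_mul (fun u : Fin n → ℝ => u k.1 ^ 2) (fun v : Fin n → ℝ => v k.2 ^ 2)]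
    congr 1
    · exact integral_comp_eval (μ := fun _ : Fin n => PU) (i := k.1) (f := fun x : ℝ => x ^ 2)
        (by fun_prop)
    · exact integral_comp_eval (μ := fun _ : Fin n => PV) (i := k.2) (f := fun x : ℝ => x ^ 2)
        (by fun_prop)
  simp_rw [h]
  rw [Finset.sum_const, Finset.card_univ, Fintype.card_prod, Fintype.card_fin, nsmul_eq_mul]
  push_cast
  ring

lemma freeEnergy_hasDerivAt (hUS : PU ((↑S : Set ℝ)ᶜ) = 0) (hVS : PV ((↑S : Set ℝ)ᶜ) = 0)
    (hn : 0 < n) {lam : ℝ} (hlam : 0 < lam) :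
    HasDerivAt (freeEnergy PU PV n) ((1 / 2) * overlapExp PU PV n lam) lam := by
  have e : freeEnergy PU PV n
      = fun lam => (1 / (n : ℝ)) * chF (wt PU PV n S) (xt n S) (lam / n) :=
    funext (freeEnergy_eq PU PV n S hUS hVS)
  rw [e, overlapExp_eq PU PV n S hUS hVS]
  have hn' : (0 : ℝ) < n := by exact_mod_cast hn
  have h1 := chF_hasDerivAt (xt n S) (div_pos hlam hn') (wt_nonneg PU PV n S)
      (wt_sum PU PV n S hUS hVS)
  have h2 := (HasDerivAt.comp lam h1 ((hasDerivAt_id lam).div_const (n : ℝ))).const_mul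
    (1 / (n : ℝ))
  refine h2.congr_deriv ?_
  field_simp

end reduction

/-- **Derivative of the free energy and I-MMSE relation.**  `λ ↦ F_n(λ)` is convex and
differentiable on `(0,∞)` with `F_n'(λ) = (1/2)·E⟨(u·U)(v·V)⟩`, and
`MMSE_n(λ) = ((n−1)/n)·E[U²]E[V²] + (1/n)·E[U²V²] − 2·F_n'(λ)`. -/
theorem free_energy_derivative_immse
    (K₀ : ℝ) (S : Finset ℝ) (hSK : ∀ x ∈ S, |x| ≤ K₀)
    (PU PV : Measure ℝ) [IsProbabilityMeasure PU] [IsProbabilityMeasure PV]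
    (hUS : PU ((↑S : Set ℝ)ᶜ) = 0) (hVS : PV ((↑S : Set ℝ)ᶜ) = 0)
    (hUvar : 0 < (∫ x, x ^ 2 ∂PU) - (∫ x, x ∂PU) ^ 2)
    (hVvar : 0 < (∫ x, x ^ 2 ∂PV) - (∫ x, x ∂PV) ^ 2)
    (n : ℕ) (hn : 0 < n) :
    ConvexOn ℝ (Set.Ioi 0) (freeEnergy PU PV n)
    ∧ ∀ lam : ℝ, 0 < lam →
        HasDerivAt (freeEnergy PU PV n) ((1 / 2) * overlapExp PU PV n lam) lam
        ∧ MMSEn PU PV n lam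
            = ((n : ℝ) - 1) / n * ((∫ x, x ^ 2 ∂PU) * (∫ x, x ^ 2 ∂PV))
              + (1 / (n : ℝ)) * (∫ p : ℝ × ℝ, p.1 ^ 2 * p.2 ^ 2 ∂(PU.prod PV))
              - 2 * deriv (freeEnergy PU PV n) lam := by
  have hn' : (0 : ℝ) < n := by exact_mod_cast hn
  have hd : ∀ lam : ℝ, 0 < lam →
      HasDerivAt (freeEnergy PU PV n) ((1 / 2) * overlapExp PU PV n lam) lam :=
    fun lam hlam => freeEnergy_hasDerivAt PU PV n S hUS hVS hn hlam
  refine ⟨?_, fun lam hlam => ⟨hd lam hlam, ?_⟩⟩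
  · refine MonotoneOn.convexOn_of_deriv (convex_Ioi 0)
      (fun a ha => (hd a ha).continuousAt.continuousWithinAt) ?_ ?_
    · rw [interior_Ioi]
      exact fun a ha => (hd a ha).differentiableAt.differentiableWithinAt
    · rw [interior_Ioi]
      intro a ha b hb hab
      have ha' : 0 < a := ha
      rw [(hd a ha).deriv, (hd b hb).deriv, overlapExp_eq PU PV n S hUS hVS,
        overlapExp_eq PU PV n S hUS hVS]
      have hm := chQ_mono (xt n S) (γ := a / n) (γ' := b / n) (by positivity) (by gcongr)
        (wt_nonneg PU PV n S) (wt_sum PU PV n S hUS hVS)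
      gcongr
  · rw [(hd lam hlam).deriv, MMSEn_eq PU PV n S hUS hVS hlam, overlapExp_eq PU PV n S hUS hVS,
      second_moment PU PV n S hUS hVS,
      integral_prod_mul (fun x : ℝ => x ^ 2) (fun x : ℝ => x ^ 2)]
    field_simp
    ring
end
end
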